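/- arXiv:2504.18417 — 5 statements merged into one kernel-verified Lean document; each statement's English description precedes it below -/
import Mathlib

section
/- Let λ_n = √(8(2n+1)² + 9)/4 for n ∈ ℕ, and let a be a real number with |a| ≠ λ_n for all n ∈ ℕ. Then there exists a function F : ℂ → ℂ with the following properties: (i) F is complex differentiable at every point of ℂ \ { −2l : l ∈ ℕ, l ≥ 1 }; (ii) for every s ∈ ℂ with Re s > 1, F(s) = ∑_{n=0}^∞ sign(a+λ_n)|a+λ_n|^{−s} + ∑_{n=0}^∞ sign(a−λ_n)|a−λ_n|^{−s}; (iii) for every integer l ≥ 1, (s + 2l)·F(s) tends, as s → −2l (along s ≠ −2l), to √2 · ∑_{j=0}^{l−1} C(2l, 2j+1)·C(2l−2j, l−j)·(9/64)^{l−j}·a^{2j+1}; (iv) F(0) = 2·sign(a)·N(a) − √2·a, where N(a) is the (finite) number of n ∈ ℕ with λ_n < |a|; (v) F(−(2l+1)) = 0 for every l ∈ ℕ. -/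
open Real Filter Topology

/-- The eigenvalue parameters `λ_n = √(8(2n+1)² + 9)/4`. -/
noncomputable def lam (n : ℕ) : ℝ := Real.sqrt (8 * (2 * n + 1) ^ 2 + 9) / 4

lemma ring_choose_eq_prod (z : ℂ) (k : ℕ) :
    Ring.choose z k = (∏ i ∈ Finset.range k, (z - i)) / (k.factorial : ℂ) := by
  rw [Ring.choose_eq_smul, ← Polynomial.aeval_eq_smeval, Polynomial.aeval_def,
    Polynomial.eval₂_eq_eval_map, descPochhammer_map, descPochhammer_eval_eq_prod_range,
    smul_eq_mul, inv_mul_eq_div]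

lemma hasSum_ring_choose_mul_pow (z : ℂ) {x : ℂ} (hx : ‖x‖ < 1) :
    HasSum (fun k : ℕ => Ring.choose z k * x ^ k) ((1 + x) ^ z) := by
  have h := (Complex.one_add_cpow_hasFPowerSeriesOnBall_zero (a := z)).hasSum (y := x)
    (by simpa [← ofReal_norm] using hx)
  simpa [binomialSeries, mul_comm] using h

lemma norm_ring_choose_neg_le {s : ℂ} {B : ℝ} (hs : ‖s‖ ≤ B) (k : ℕ) :
    ‖Ring.choose (-s) k‖ ≤ ‖Ring.choose (-(B : ℂ)) k‖ := by
  have hB : 0 ≤ B := (norm_nonneg s).trans hs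
  rw [ring_choose_eq_prod, ring_choose_eq_prod, norm_div, norm_div, norm_prod, norm_prod]
  gcongr with i
  have h1 : ‖-(B : ℂ) - i‖ = B + i := by
    rw [← neg_add', norm_neg]
    have : (B : ℂ) + i = ((B + i : ℝ) : ℂ) := by push_cast; rfl
    rw [this, Complex.norm_real, Real.norm_of_nonneg (by positivity)]
  rw [h1, ← neg_add', norm_neg]
  calc ‖s + i‖ ≤ ‖s‖ + ‖(i : ℂ)‖ := norm_add_le _ _
    _ ≤ B + i := by simpa using hs

lemma norm_ring_choose_neg_ofReal {B : ℝ} (hB : 0 ≤ B) (k : ℕ) :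
    (‖Ring.choose (-(B : ℂ)) k‖ : ℂ) = Ring.choose (-(B : ℂ)) k * (-1) ^ k := by
  have h1 (i : ℕ) : (‖-(B : ℂ) - i‖ : ℂ) = (-(B : ℂ) - i) * (-1) := by
    rw [← neg_add', norm_neg]
    have : (B : ℂ) + i = ((B + i : ℝ) : ℂ) := by push_cast; rfl
    rw [this, Complex.norm_real, Real.norm_of_nonneg (by positivity)]
    ring
  rw [ring_choose_eq_prod, norm_div, norm_prod]
  push_cast
  simp_rw [h1]
  rw [Finset.prod_mul_distrib]
  simp
  ring

lemma hasSum_norm_ring_choose_neg_mul_pow {B y : ℝ} (hB : 0 ≤ B) (hy : 0 ≤ y) (hy1 : y < 1) :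
    HasSum (fun k : ℕ => ‖Ring.choose (-(B : ℂ)) k‖ * y ^ k) ((1 - y) ^ (-B)) := by
  have h := hasSum_ring_choose_mul_pow (-(B : ℂ)) (x := -(y : ℂ))
    (by simpa [abs_of_nonneg hy] using hy1)
  rw [← Complex.hasSum_ofReal]
  convert! h using 1
  · ext k
    push_cast
    rw [norm_ring_choose_neg_ofReal hB, neg_pow (y : ℂ)]
    ring
  · rw [Complex.ofReal_cpow (by linarith)]
    push_cast
    ring_nf

lemma differentiable_ring_choose {f : ℂ → ℂ} (hf : Differentiable ℂ f) (k : ℕ) :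
    Differentiable ℂ fun s => Ring.choose (f s) k := by
  simp_rw [ring_choose_eq_prod]
  fun_prop

/-- The square roots `(2n+1)/√2` of the leading part of `λ_n²`. -/
noncomputable def node (n : ℕ) : ℝ := Real.sqrt 2 * (n + 1 / 2)

lemma node_pos (n : ℕ) : 0 < node n := by unfold node; positivity

lemma node_mono {m n : ℕ} (h : m ≤ n) : node m ≤ node n := by
  unfold node; gcongr

lemma lam_eq_sqrt (n : ℕ) : lam n = Real.sqrt (node n ^ 2 + 9 / 16) := by
  have h : node n ^ 2 + 9 / 16 = (8 * (2 * n + 1) ^ 2 + 9) / 4 ^ 2 := by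
    unfold node
    rw [mul_pow, Real.sq_sqrt (by norm_num)]
    ring
  rw [h, Real.sqrt_div (by positivity), Real.sqrt_sq (by norm_num), lam]

lemma lam_sq (n : ℕ) : lam n ^ 2 = node n ^ 2 + 9 / 16 := by
  rw [lam_eq_sqrt, Real.sq_sqrt (by positivity)]

lemma lam_pos (n : ℕ) : 0 < lam n := by
  rw [lam_eq_sqrt]; positivity

/-- The coefficient of `a^(2j+1) (9/16)^k μ^(-s-2j-2k-1)`, together with the powers of `a` and
`9/16`, in the expansion of `(λ+a)^(-s) - (λ-a)^(-s)` where `λ² = μ² + 9/16`. -/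
noncomputable def expansionTerm (a : ℝ) (s : ℂ) (j k : ℕ) : ℂ :=
  2 * Ring.choose (-s) (2 * j + 1) * Ring.choose (-((s + (2 * j + 1)) / 2)) k *
    (a : ℂ) ^ (2 * j + 1) * (9 / 16) ^ k

/-- A bound for `‖expansionTerm a s j k‖` on the disc `‖s‖ ≤ B`. -/
noncomputable def expansionBound (a B : ℝ) (j k : ℕ) : ℝ :=
  2 * ‖Ring.choose (-(B : ℂ)) (2 * j + 1)‖ *
    ‖Ring.choose (-(((B + (2 * j + 1)) / 2 : ℝ) : ℂ)) k‖ * |a| ^ (2 * j + 1) * (9 / 16) ^ k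

lemma expansionBound_nonneg (a B : ℝ) (j k : ℕ) : 0 ≤ expansionBound a B j k := by
  unfold expansionBound; positivity

lemma norm_expansionTerm_le (a : ℝ) {s : ℂ} {B : ℝ} (hs : ‖s‖ ≤ B) (j k : ℕ) :
    ‖expansionTerm a s j k‖ ≤ expansionBound a B j k := by
  have h1 := norm_ring_choose_neg_le hs (2 * j + 1)
  have h2 : ‖(s + (2 * j + 1)) / 2‖ ≤ (B + (2 * j + 1)) / 2 := by
    rw [norm_div]
    have h3 : ‖(2 * j + 1 : ℂ)‖ = 2 * j + 1 := by
      have : (2 * j + 1 : ℂ) = ((2 * j + 1 : ℕ) : ℂ) := by push_cast; rfl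
      rw [this, Complex.norm_natCast]; push_cast; rfl
    have h4 : ‖s + (2 * j + 1)‖ ≤ B + (2 * j + 1) :=
      (norm_add_le _ _).trans (by rw [h3]; gcongr)
    simpa using div_le_div_of_nonneg_right h4 (by norm_num : (0 : ℝ) ≤ 2)
  have h5 := norm_ring_choose_neg_le h2 k
  have h6 : ‖(9 / 16 : ℂ)‖ = 9 / 16 := by norm_num
  unfold expansionTerm expansionBound
  rw [norm_mul, norm_mul, norm_mul, norm_mul, norm_pow, norm_pow, Complex.norm_real, h6,
    Complex.norm_ofNat, Real.norm_eq_abs]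
  gcongr

lemma summable_expansionBound {a B μ : ℝ} (hB : 0 ≤ B) (hμ : 0 < μ) (ha : a ^ 2 + 9 / 16 < μ ^ 2) :
    Summable fun p : ℕ × ℕ => expansionBound a B p.1 p.2 * μ⁻¹ ^ (2 * (p.1 + p.2)) := by
  set y : ℝ := 9 / 16 * μ⁻¹ ^ 2 with hy
  have hy0 : 0 ≤ y := by positivity
  have hy1 : a ^ 2 * μ⁻¹ ^ 2 < 1 - y := by
    have : (a ^ 2 + 9 / 16) * μ⁻¹ ^ 2 < 1 := by
      rw [inv_pow, ← div_eq_mul_inv, div_lt_one (by positivity)]; exact ha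
    rw [hy]; linarith
  have hy2 : 0 < 1 - y := lt_of_le_of_lt (by positivity) hy1
  set r : ℝ := (1 - y) ^ (-(1 / 2) : ℝ) with hr
  have hr0 : 0 < r := Real.rpow_pos_of_pos hy2 _
  have hr2 : r ^ 2 = (1 - y)⁻¹ := by
    rw [hr, ← Real.rpow_natCast, ← Real.rpow_mul hy2.le, ← Real.rpow_neg_one]
    norm_num
  have ht : |a| * μ⁻¹ * r < 1 := by
    have h0 : 0 ≤ |a| * μ⁻¹ * r := by positivity
    rw [← sq_lt_one_iff₀ h0, mul_pow, mul_pow, sq_abs, hr2, ← div_eq_mul_inv, div_lt_one hy2]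
    exact hy1
  have inner (j : ℕ) : HasSum (fun k => expansionBound a B j k * μ⁻¹ ^ (2 * (j + k)))
      (2 * μ * (1 - y) ^ (-B / 2) *
        (‖Ring.choose (-(B : ℂ)) (2 * j + 1)‖ * (|a| * μ⁻¹ * r) ^ (2 * j + 1))) := by
    have h := (hasSum_norm_ring_choose_neg_mul_pow (B := (B + (2 * j + 1)) / 2) (by positivity)
      hy0 (by linarith)).mul_left
        (2 * ‖Ring.choose (-(B : ℂ)) (2 * j + 1)‖ * |a| ^ (2 * j + 1) * μ⁻¹ ^ (2 * j))
    convert! h using 1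
    · ext k
      rw [expansionBound, hy]
      ring
    · have h1 : (1 - y) ^ (-((B + (2 * j + 1)) / 2)) = (1 - y) ^ (-B / 2) * r ^ (2 * j + 1) := by
        rw [hr, ← Real.rpow_natCast, ← Real.rpow_mul hy2.le, ← Real.rpow_add hy2]
        congr 1
        push_cast
        ring
      rw [h1]
      have h2 : μ * (|a| * μ⁻¹ * r) ^ (2 * j + 1) =
          |a| ^ (2 * j + 1) * μ⁻¹ ^ (2 * j) * r ^ (2 * j + 1) := by
        rw [mul_pow, mul_pow, pow_succ μ⁻¹]
        field_simp
      linear_combination (2 * (1 - y) ^ (-B / 2) * ‖Ring.choose (-(B : ℂ)) (2 * j + 1)‖) * h2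
  rw [summable_prod_of_nonneg fun p => mul_nonneg (expansionBound_nonneg _ _ _ _) (by positivity)]
  refine ⟨fun j => (inner j).summable, ?_⟩
  simp_rw [fun j => (inner j).tsum_eq]
  refine Summable.mul_left _ ?_
  exact (hasSum_norm_ring_choose_neg_mul_pow hB (by positivity) ht).summable.comp_injective
    (i := fun j : ℕ => 2 * j + 1) fun i j h => by simpa using h

lemma hasSum_odd_sub {z x : ℂ} (hx : ‖x‖ < 1) :
    HasSum (fun j : ℕ => 2 * Ring.choose z (2 * j + 1) * x ^ (2 * j + 1))
      ((1 + x) ^ z - (1 - x) ^ z) := by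
  have h := (hasSum_ring_choose_mul_pow z hx).sub
    (hasSum_ring_choose_mul_pow z (x := -x) (by simpa using hx))
  rw [← sub_eq_add_neg] at h
  have hinj : Function.Injective fun j : ℕ => 2 * j + 1 := fun i j h => by simpa using h
  rw [← hinj.hasSum_iff] at h
  · convert! h using 1
    ext j
    have h1 : Odd (2 * j + 1) := ⟨j, rfl⟩
    simp only [Function.comp, h1.neg_pow]
    ring
  · intro n hn
    have h1 : Even n := by
      rw [← Nat.not_odd_iff_even]
      rintro ⟨j, rfl⟩
      exact hn ⟨j, rfl⟩
    rw [h1.neg_pow, sub_self]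

lemma ofReal_cpow_eq_exp {x : ℝ} (hx : 0 < x) (z : ℂ) :
    (x : ℂ) ^ z = Complex.exp (Real.log x * z) := by
  rw [Complex.cpow_def_of_ne_zero (by exact_mod_cast hx.ne'), Complex.ofReal_log hx.le]

lemma cpow_neg_add_nat {x : ℝ} (hx : 0 < x) (s : ℂ) (n : ℕ) :
    (x : ℂ) ^ (-(s + n)) = (x : ℂ) ^ (-s) * ((x : ℂ)⁻¹) ^ n := by
  have hx' : (x : ℂ) ≠ 0 := by exact_mod_cast hx.ne'
  rw [neg_add, Complex.cpow_add _ _ hx', Complex.cpow_neg _ (n : ℂ), Complex.cpow_natCast, inv_pow]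

lemma abs_lt_of_sq_add_lt {a μ l : ℝ} (ha : a ^ 2 + 9 / 16 < μ ^ 2)
    (hl : l ^ 2 = μ ^ 2 + 9 / 16) (hl0 : 0 < l) : |a| < l :=
  abs_lt_of_sq_lt_sq (by linarith) hl0.le

lemma hasSum_expansionTerm_inner {a μ l : ℝ} (hμ : 0 < μ) (ha : a ^ 2 + 9 / 16 < μ ^ 2)
    (hl : l ^ 2 = μ ^ 2 + 9 / 16) (hl0 : 0 < l) (s : ℂ) (j : ℕ) :
    HasSum (fun k : ℕ => expansionTerm a s j k * (μ : ℂ) ^ (-(s + (2 * (j + k) + 1 : ℕ))))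
      ((l : ℂ) ^ (-s) * (2 * Ring.choose (-s) (2 * j + 1) * ((a / l : ℝ) : ℂ) ^ (2 * j + 1))) := by
  have hy : ‖(9 / 16 * (μ : ℂ)⁻¹ ^ 2)‖ < 1 := by
    have h1 : (9 / 16 * (μ : ℂ)⁻¹ ^ 2) = ((9 / 16 * μ⁻¹ ^ 2 : ℝ) : ℂ) := by push_cast; rfl
    rw [h1, Complex.norm_real, Real.norm_of_nonneg (by positivity), inv_pow, ← div_eq_mul_inv,
      div_lt_one (by positivity)]
    nlinarith [sq_nonneg a]
  have h := (hasSum_ring_choose_mul_pow (-((s + (2 * j + 1)) / 2)) hy).mul_left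
    (2 * Ring.choose (-s) (2 * j + 1) * (a : ℂ) ^ (2 * j + 1) *
      (μ : ℂ) ^ (-(s + (2 * j + 1 : ℕ))))
  convert! h using 1
  · ext k
    rw [cpow_neg_add_nat hμ, cpow_neg_add_nat hμ, expansionTerm]
    ring
  · have h1 : (1 + 9 / 16 * (μ : ℂ)⁻¹ ^ 2) = (((l / μ) ^ 2 : ℝ) : ℂ) := by
      rw [div_pow, hl]
      have : (μ : ℂ) ≠ 0 := by exact_mod_cast hμ.ne'
      push_cast
      field_simp
    have h2 : (μ : ℂ) ^ (-(s + (2 * j + 1 : ℕ))) * (1 + 9 / 16 * (μ : ℂ)⁻¹ ^ 2) ^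
        (-((s + (2 * j + 1)) / 2)) = (l : ℂ) ^ (-(s + (2 * j + 1 : ℕ))) := by
      rw [h1, ofReal_cpow_eq_exp hμ, ofReal_cpow_eq_exp (by positivity), ofReal_cpow_eq_exp hl0,
        ← Complex.exp_add, Real.log_pow, Real.log_div hl0.ne' hμ.ne']
      congr 1
      push_cast
      ring
    rw [cpow_neg_add_nat hl0] at h2
    rw [Complex.ofReal_div, div_eq_mul_inv, mul_pow]
    linear_combination -(2 * Ring.choose (-s) (2 * j + 1) * (a : ℂ) ^ (2 * j + 1)) * h2

lemma norm_expansionTerm_mul_cpow_le (a : ℝ) {μ : ℝ} (hμ : 0 < μ) (s : ℂ) (p : ℕ × ℕ) :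
    ‖expansionTerm a s p.1 p.2 * (μ : ℂ) ^ (-(s + (2 * (p.1 + p.2) + 1 : ℕ)))‖ ≤
      expansionBound a ‖s‖ p.1 p.2 * μ⁻¹ ^ (2 * (p.1 + p.2)) * μ ^ (-(s.re + 1)) := by
  rw [norm_mul, Complex.norm_cpow_eq_rpow_re_of_pos hμ, mul_assoc]
  refine mul_le_mul (norm_expansionTerm_le a le_rfl _ _) (le_of_eq ?_) (by positivity)
    (expansionBound_nonneg _ _ _ _)
  rw [inv_pow, ← Real.rpow_natCast, ← Real.rpow_neg hμ.le, ← Real.rpow_add hμ]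
  congr 1
  simp
  ring

lemma hasSum_expansionTerm {a μ l : ℝ} (hμ : 0 < μ) (ha : a ^ 2 + 9 / 16 < μ ^ 2)
    (hl : l ^ 2 = μ ^ 2 + 9 / 16) (hl0 : 0 < l) (s : ℂ) :
    HasSum (fun p : ℕ × ℕ =>
        expansionTerm a s p.1 p.2 * (μ : ℂ) ^ (-(s + (2 * (p.1 + p.2) + 1 : ℕ))))
      (((l + a : ℝ) : ℂ) ^ (-s) - ((l - a : ℝ) : ℂ) ^ (-s)) := by
  have hs : Summable fun p : ℕ × ℕ =>
      expansionTerm a s p.1 p.2 * (μ : ℂ) ^ (-(s + (2 * (p.1 + p.2) + 1 : ℕ))) :=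
    .of_norm_bounded ((summable_expansionBound (norm_nonneg s) hμ ha).mul_right _)
      (norm_expansionTerm_mul_cpow_le a hμ s)
  have hal := abs_lt_of_sq_add_lt ha hl hl0
  have h1 := hs.hasSum.prod_fiberwise
    fun j => hasSum_expansionTerm_inner hμ ha hl hl0 s j
  have hx : ‖((a / l : ℝ) : ℂ)‖ < 1 := by
    rw [Complex.norm_real, Real.norm_eq_abs, abs_div, abs_of_pos hl0, div_lt_one hl0]
    exact hal
  have h2 := (hasSum_odd_sub (z := -s) hx).mul_left ((l : ℂ) ^ (-s))
  have h3 := abs_lt.1 hal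
  have h4 : (l : ℂ) ^ (-s) * ((1 + ((a / l : ℝ) : ℂ)) ^ (-s) - (1 - ((a / l : ℝ) : ℂ)) ^ (-s)) =
      ((l + a : ℝ) : ℂ) ^ (-s) - ((l - a : ℝ) : ℂ) ^ (-s) := by
    have h5 : l + a = l * (1 + a / l) := by field_simp
    have h6 : l - a = l * (1 - a / l) := by field_simp
    have h7 : 0 < 1 + a / l := by
      have := h5 ▸ (by linarith : 0 < l + a)
      exact pos_of_mul_pos_right this hl0.le
    have h8 : 0 < 1 - a / l := by
      have := h6 ▸ (by linarith : 0 < l - a)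
      exact pos_of_mul_pos_right this hl0.le
    rw [h5, h6, Complex.ofReal_mul, Complex.ofReal_mul,
      Complex.mul_cpow_ofReal_nonneg hl0.le h7.le, Complex.mul_cpow_ofReal_nonneg hl0.le h8.le]
    push_cast
    ring
  rw [← h4, ← h1.unique h2]
  exact hs.hasSum

/-- The meromorphic continuation of `∑_{n ≥ N} (node n)^(-z)`. -/
noncomputable def nodeZeta (N : ℕ) (z : ℂ) : ℂ :=
  ((Real.sqrt 2 : ℝ) : ℂ) ^ (-z) * HurwitzZeta.hurwitzZeta ((1 / 2 : ℝ) : UnitAddCircle) z -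
    ∑ n ∈ Finset.range N, (node n : ℂ) ^ (-z)

lemma node_cpow (n : ℕ) (z : ℂ) :
    (node n : ℂ) ^ (-z) =
      ((Real.sqrt 2 : ℝ) : ℂ) ^ (-z) * (1 / ((n : ℂ) + ((1 / 2 : ℝ) : ℂ)) ^ z) := by
  rw [node, Complex.ofReal_mul, Complex.mul_cpow_ofReal_nonneg (by positivity) (by positivity),
    Complex.cpow_neg ((n + 1 / 2 : ℝ) : ℂ), one_div (_ ^ z)]
  push_cast
  rfl

lemma hasSum_nodeZeta (N : ℕ) {z : ℂ} (hz : 1 < z.re) :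
    HasSum (fun n => (node (n + N) : ℂ) ^ (-z)) (nodeZeta N z) := by
  rw [nodeZeta, hasSum_nat_add_iff' (f := fun n => (node n : ℂ) ^ (-z))]
  simp_rw [node_cpow]
  exact (HurwitzZeta.hasSum_hurwitzZeta_of_one_lt_re (by norm_num) hz).mul_left _

lemma differentiable_cpow_neg {x : ℝ} (hx : 0 < x) :
    Differentiable ℂ fun z : ℂ => (x : ℂ) ^ (-z) := by
  have hx' : (x : ℂ) ≠ 0 := by exact_mod_cast hx.ne'
  exact fun z => differentiableAt_id.neg.const_cpow (Or.inl hx')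

lemma differentiable_sum_node_cpow (N : ℕ) :
    Differentiable ℂ fun z : ℂ => ∑ n ∈ Finset.range N, (node n : ℂ) ^ (-z) :=
  Differentiable.fun_sum fun n _ => differentiable_cpow_neg (node_pos n)

lemma differentiableAt_nodeZeta (N : ℕ) {z : ℂ} (hz : z ≠ 1) :
    DifferentiableAt ℂ (nodeZeta N) z :=
  ((differentiable_cpow_neg (by positivity) z).mul
    (HurwitzZeta.differentiableAt_hurwitzZeta _ hz)).sub (differentiable_sum_node_cpow N z)

lemma nodeZeta_residue_one (N : ℕ) :
    Tendsto (fun z => (z - 1) * nodeZeta N z) (𝓝[≠] 1) (𝓝 ((Real.sqrt 2 : ℝ) : ℂ)⁻¹) := by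
  have h1 : Tendsto (fun z : ℂ => ((Real.sqrt 2 : ℝ) : ℂ) ^ (-z)) (𝓝[≠] 1)
      (𝓝 (((Real.sqrt 2 : ℝ) : ℂ) ^ (-1 : ℂ))) :=
    ((differentiable_cpow_neg (by positivity)).continuous.tendsto 1).mono_left nhdsWithin_le_nhds
  have h2 : Tendsto (fun z : ℂ => (z - 1) * ∑ n ∈ Finset.range N, (node n : ℂ) ^ (-z)) (𝓝[≠] 1)
      (𝓝 ((1 - 1) * ∑ n ∈ Finset.range N, (node n : ℂ) ^ (-1 : ℂ))) :=
    ((continuous_id.sub continuous_const).mul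
      (differentiable_sum_node_cpow N).continuous).tendsto 1 |>.mono_left nhdsWithin_le_nhds
  convert! (h1.mul (HurwitzZeta.hurwitzZeta_residue_one
    ((1 / 2 : ℝ) : UnitAddCircle))).sub h2 using 1
  · ext z
    rw [nodeZeta]
    ring
  · rw [Complex.cpow_neg_one]
    simp

lemma exists_norm_nodeZeta_le (N : ℕ) :
    ∃ C : ℝ, 0 ≤ C ∧ ∀ z : ℂ, 2 ≤ z.re → ‖nodeZeta N z‖ ≤ C * node N ^ (-z.re) := by
  have hsum : Summable fun n => node (n + N) ^ (-2 : ℝ) := by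
    have h := (hasSum_nodeZeta N (z := 2) (by simp)).summable.norm
    convert! h using 2 with n
    rw [Complex.norm_cpow_eq_rpow_re_of_pos (node_pos _)]
    simp
  refine ⟨node N ^ (2 : ℝ) * ∑' n, node (n + N) ^ (-2 : ℝ),
    mul_nonneg (Real.rpow_nonneg (node_pos N).le _)
      (tsum_nonneg fun n => Real.rpow_nonneg (node_pos _).le _), fun z hz => ?_⟩
  rw [← (hasSum_nodeZeta N (by linarith : 1 < z.re)).tsum_eq]
  refine tsum_of_norm_bounded (g := fun n => node N ^ (2 : ℝ) * node N ^ (-z.re) *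
    node (n + N) ^ (-2 : ℝ)) ?_ fun n => ?_
  · convert! hsum.hasSum.mul_left (node N ^ (2 : ℝ) * node N ^ (-z.re)) using 1
    ring
  · rw [Complex.norm_cpow_eq_rpow_re_of_pos (node_pos _), ← Real.rpow_add (node_pos N)]
    have h1 : node (n + N) ^ (-z).re = node (n + N) ^ (2 - z.re) * node (n + N) ^ (-2 : ℝ) := by
      rw [← Real.rpow_add (node_pos _)]
      congr 1
      simp only [Complex.neg_re]
      ring
    rw [h1, ← sub_eq_add_neg]
    exact mul_le_mul_of_nonneg_right
      (Real.rpow_le_rpow_of_nonpos (node_pos N) (node_mono (by lia)) (by linarith))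
      (Real.rpow_nonneg (node_pos _).le _)

lemma half_ne_zero_unitAddCircle : ((1 / 2 : ℝ) : UnitAddCircle) ≠ 0 := by
  rw [Ne, AddCircle.coe_eq_zero_iff]
  rintro ⟨n, hn⟩
  have h1 : ((2 * n : ℤ) : ℝ) = (1 : ℤ) := by push_cast; simp at hn; linarith
  have h2 : 2 * n = 1 := by exact_mod_cast h1
  lia

lemma hurwitzZeta_half_neg_two_mul (m : ℕ) :
    HurwitzZeta.hurwitzZeta ((1 / 2 : ℝ) : UnitAddCircle) (-(2 * m)) = 0 := by
  have hneg : -((1 / 2 : ℝ) : UnitAddCircle) = ((1 / 2 : ℝ) : UnitAddCircle) := by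
    rw [← AddCircle.coe_neg, ← sub_eq_zero, ← AddCircle.coe_sub, AddCircle.coe_eq_zero_iff]
    exact ⟨-1, by norm_num⟩
  have hodd (z : ℂ) : HurwitzZeta.hurwitzZetaOdd ((1 / 2 : ℝ) : UnitAddCircle) z = 0 := by
    have h := HurwitzZeta.hurwitzZetaOdd_neg ((1 / 2 : ℝ) : UnitAddCircle) z
    rw [hneg] at h
    exact self_eq_neg.1 h
  rw [HurwitzZeta.hurwitzZeta, hodd, add_zero]
  cases m with
  | zero =>
    rw [Nat.cast_zero, mul_zero, neg_zero, HurwitzZeta.hurwitzZetaEven_apply_zero,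
      if_neg half_ne_zero_unitAddCircle]
  | succ m =>
    have := HurwitzZeta.hurwitzZetaEven_neg_two_mul_nat_add_one ((1 / 2 : ℝ) : UnitAddCircle) m
    rw [← this]
    congr 1
    push_cast
    ring

lemma nodeZeta_neg_two_mul (N m : ℕ) :
    nodeZeta N (-(2 * m)) = -∑ n ∈ Finset.range N, (node n : ℂ) ^ (2 * m) := by
  rw [nodeZeta, hurwitzZeta_half_neg_two_mul, mul_zero, zero_sub, neg_neg]
  congr 1
  refine Finset.sum_congr rfl fun n _ => ?_
  rw [← Complex.cpow_natCast]
  push_cast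
  rfl

/-- The coefficient of `μ^(-s-2m-1)` in the expansion of `(λ+a)^(-s) - (λ-a)^(-s)`, where
`λ² = μ² + 9/16`. -/
noncomputable def expansionCoeff (a : ℝ) (m : ℕ) (s : ℂ) : ℂ :=
  ∑ p ∈ Finset.HasAntidiagonal.antidiagonal m, expansionTerm a s p.1 p.2

/-- A bound for `‖expansionCoeff a m s‖` on the disc `‖s‖ ≤ B`. -/
noncomputable def expansionCoeffBound (a B : ℝ) (m : ℕ) : ℝ :=
  ∑ p ∈ Finset.HasAntidiagonal.antidiagonal m, expansionBound a B p.1 p.2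

lemma expansionCoeffBound_nonneg (a B : ℝ) (m : ℕ) : 0 ≤ expansionCoeffBound a B m :=
  Finset.sum_nonneg fun _ _ => expansionBound_nonneg _ _ _ _

lemma norm_expansionCoeff_le (a : ℝ) {s : ℂ} {B : ℝ} (hs : ‖s‖ ≤ B) (m : ℕ) :
    ‖expansionCoeff a m s‖ ≤ expansionCoeffBound a B m :=
  norm_sum_le_of_le _ fun _ _ => norm_expansionTerm_le a hs _ _

lemma differentiable_expansionCoeff (a : ℝ) (m : ℕ) : Differentiable ℂ (expansionCoeff a m) := by
  refine Differentiable.fun_sum fun p _ => ?_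
  unfold expansionTerm
  have h1 := differentiable_ring_choose (f := fun s => -s) (by fun_prop) (2 * p.1 + 1)
  have h2 := differentiable_ring_choose (f := fun s => -((s + (2 * p.1 + 1)) / 2))
    (by fun_prop) p.2
  fun_prop

lemma HasSum.sum_antidiagonal {E : Type*} [AddCommMonoid E] [TopologicalSpace E]
    [ContinuousAdd E] [RegularSpace E] {f : ℕ × ℕ → E} {x : E} (h : HasSum f x) :
    HasSum (fun m => ∑ p ∈ Finset.HasAntidiagonal.antidiagonal m, f p) x := by
  refine (Finset.HasAntidiagonal.sigmaAntidiagonalEquivProd.hasSum_iff.2 h).sigma fun m => ?_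
  exact (Finset.HasAntidiagonal.antidiagonal m).hasSum f

lemma summable_expansionCoeffBound {a B μ : ℝ} (hB : 0 ≤ B) (hμ : 0 < μ)
    (ha : a ^ 2 + 9 / 16 < μ ^ 2) :
    Summable fun m => expansionCoeffBound a B m * μ⁻¹ ^ (2 * m) := by
  convert! (summable_expansionBound hB hμ ha).hasSum.sum_antidiagonal.summable using 2 with m
  rw [expansionCoeffBound, Finset.sum_mul]
  exact Finset.sum_congr rfl fun p hp => by rw [Finset.HasAntidiagonal.mem_antidiagonal.1 hp]

lemma hasSum_expansionCoeff {a μ l : ℝ} (hμ : 0 < μ) (ha : a ^ 2 + 9 / 16 < μ ^ 2)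
    (hl : l ^ 2 = μ ^ 2 + 9 / 16) (hl0 : 0 < l) (s : ℂ) :
    HasSum (fun m : ℕ => expansionCoeff a m s * (μ : ℂ) ^ (-(s + (2 * m + 1 : ℕ))))
      (((l + a : ℝ) : ℂ) ^ (-s) - ((l - a : ℝ) : ℂ) ^ (-s)) := by
  convert! (hasSum_expansionTerm hμ ha hl hl0 s).sum_antidiagonal using 2 with m
  rw [expansionCoeff, Finset.sum_mul]
  exact Finset.sum_congr rfl fun p hp => by rw [Finset.HasAntidiagonal.mem_antidiagonal.1 hp]

/-- The terms with index outside `S` of the continued series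
`∑ₘ expansionCoeff a m s * nodeZeta N (s + 2m + 1)`. -/
noncomputable def zetaTerm (a : ℝ) (N : ℕ) (S : Finset ℕ) (m : ℕ) (s : ℂ) : ℂ :=
  if m ∈ S then 0 else expansionCoeff a m s * nodeZeta N (s + (2 * m + 1 : ℕ))

/-- The continued series with the indices in `S` left out. -/
noncomputable def zetaSeries (a : ℝ) (N : ℕ) (S : Finset ℕ) (s : ℂ) : ℂ :=
  ∑' m, zetaTerm a N S m s

lemma exists_norm_zetaTerm_le (a : ℝ) {N : ℕ} (hN1 : 1 ≤ node N) (S : Finset ℕ) (B : ℝ) :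
    ∃ C : ℝ, ∀ (m : ℕ) (s : ℂ), ‖s‖ ≤ B → B + 1 ≤ 2 * m →
      ‖zetaTerm a N S m s‖ ≤ expansionCoeffBound a B m * (node N)⁻¹ ^ (2 * m) * C := by
  obtain ⟨C, hC0, hC⟩ := exists_norm_nodeZeta_le N
  have hpos := node_pos N
  refine ⟨C * node N ^ B, fun m s hs hm => ?_⟩
  have h0 := expansionCoeffBound_nonneg a B m
  rw [zetaTerm]
  split_ifs
  · rw [norm_zero]
    positivity
  have hre : -B ≤ s.re := (abs_le.1 ((Complex.abs_re_le_norm s).trans hs)).1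
  have hre2 : (s + (2 * m + 1 : ℕ)).re = s.re + (2 * m + 1) := by simp
  rw [norm_mul]
  calc ‖expansionCoeff a m s‖ * ‖nodeZeta N (s + (2 * m + 1 : ℕ))‖
      ≤ expansionCoeffBound a B m * (C * node N ^ (-(s.re + (2 * m + 1)))) := by
        refine mul_le_mul (norm_expansionCoeff_le a hs m) ?_ (norm_nonneg _) h0
        rw [← hre2]
        exact hC _ (by rw [hre2]; linarith)
    _ ≤ expansionCoeffBound a B m * (C * (node N ^ B * (node N)⁻¹ ^ (2 * m))) := by
        gcongr
        rw [inv_pow, ← Real.rpow_natCast, ← Real.rpow_neg hpos.le, ← Real.rpow_add hpos]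
        refine Real.rpow_le_rpow_of_exponent_le hN1 ?_
        push_cast
        linarith
    _ = _ := by ring

lemma summable_zetaTerm {a : ℝ} {N : ℕ} (hN1 : 1 ≤ node N)
    (ha : a ^ 2 + 9 / 16 < node N ^ 2) (S : Finset ℕ) (s : ℂ) : Summable fun m => zetaTerm a N S m s := by
  obtain ⟨C, hC⟩ := exists_norm_zetaTerm_le a hN1 S ‖s‖
  obtain ⟨M, hM⟩ := exists_nat_ge (‖s‖ + 1)
  refine Summable.of_norm_bounded_eventually_nat
    ((summable_expansionCoeffBound (norm_nonneg s) (node_pos N) ha).mul_right C) ?_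
  filter_upwards [eventually_ge_atTop M] with m hm
  have : (M : ℝ) ≤ m := by exact_mod_cast hm
  exact hC m s le_rfl (by linarith [norm_nonneg s])

lemma zetaSeries_eq_add_insert {a : ℝ} {N : ℕ} (hN1 : 1 ≤ node N)
    (ha : a ^ 2 + 9 / 16 < node N ^ 2) {S : Finset ℕ} {l : ℕ} (hl : l ∉ S) (s : ℂ) :
    zetaSeries a N S s = expansionCoeff a l s * nodeZeta N (s + (2 * l + 1 : ℕ)) +
      zetaSeries a N (insert l S) s := by
  rw [zetaSeries, (summable_zetaTerm hN1 ha S s).tsum_eq_add_tsum_ite l, zetaTerm, if_neg hl,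
    zetaSeries]
  congr 2
  ext m
  simp only [zetaTerm, Finset.mem_insert]
  grind

lemma differentiableAt_zetaTerm {a : ℝ} {N : ℕ} {S : Finset ℕ} {m : ℕ} {s : ℂ} (h : m ∉ S → s ≠ -(2 * m)) :
    DifferentiableAt ℂ (zetaTerm a N S m) s := by
  unfold zetaTerm
  split_ifs with hm
  · fun_prop
  · refine (differentiable_expansionCoeff a m s).mul ?_
    refine DifferentiableAt.comp s (differentiableAt_nodeZeta N fun h1 => h hm ?_)
      (by fun_prop)
    push_cast at h1
    linear_combination h1

lemma differentiableAt_zetaSeries {a : ℝ} {N : ℕ} (hN1 : 1 ≤ node N)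
    (ha : a ^ 2 + 9 / 16 < node N ^ 2) {S : Finset ℕ} {s : ℂ} (h : ∀ m ∉ S, s ≠ -(2 * m)) :
    DifferentiableAt ℂ (zetaSeries a N S) s := by
  set B := ‖s‖ + 1 with hB
  have hB0 : 0 ≤ B := by positivity
  obtain ⟨C, hC⟩ := exists_norm_zetaTerm_le a hN1 S B
  obtain ⟨M, hM⟩ := exists_nat_ge (B + 1)
  have hsplit : zetaSeries a N S = fun w => ∑ m ∈ Finset.range M, zetaTerm a N S m w +
      ∑' m, zetaTerm a N S (m + M) w := by
    ext w
    exact ((summable_zetaTerm hN1 ha S w).sum_add_tsum_nat_add M).symm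
  have hball (w : ℂ) (hw : w ∈ Metric.ball s 1) : ‖w‖ ≤ B := by
    rw [mem_ball_iff_norm] at hw
    have := norm_le_norm_add_norm_sub' w s
    linarith
  have hMm (m : ℕ) : B + 1 ≤ 2 * (m + M : ℕ) := by
    push_cast
    linarith [m.cast_nonneg (α := ℝ)]
  have htail : DifferentiableOn ℂ (fun w => ∑' m, zetaTerm a N S (m + M) w)
      (Metric.ball s 1) := by
    refine Complex.differentiableOn_tsum_of_summable_norm
      (u := fun m => expansionCoeffBound a B (m + M) * (node N)⁻¹ ^ (2 * (m + M)) * C)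
      ?_ (fun m w hw => ?_) Metric.isOpen_ball fun m w hw => hC _ _ (hball w hw) (hMm m)
    · exact (summable_nat_add_iff M).2
        ((summable_expansionCoeffBound hB0 (node_pos N) ha).mul_right C)
    · refine (differentiableAt_zetaTerm fun _ hw' => ?_).differentiableWithinAt
      have h1 := hball w hw
      have h2 : ‖w‖ = 2 * (m + M : ℕ) := by
        rw [hw', norm_neg, norm_mul, Complex.norm_natCast, Complex.norm_ofNat]
      linarith [hMm m]
  rw [hsplit]
  exact (DifferentiableAt.fun_sum fun m _ => differentiableAt_zetaTerm (h m)).add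
    (htail.differentiableAt (Metric.ball_mem_nhds s one_pos))

/-- The contribution of `a + λ_n` and `a - λ_n` to the eta function. -/
noncomputable def signedPowerPair (a : ℝ) (n : ℕ) (s : ℂ) : ℂ :=
  (Real.sign (a + lam n) : ℂ) * ((|a + lam n| : ℝ) : ℂ) ^ (-s) +
    (Real.sign (a - lam n) : ℂ) * ((|a - lam n| : ℝ) : ℂ) ^ (-s)

lemma abs_lt_lam {a : ℝ} {n : ℕ} (ha : a ^ 2 + 9 / 16 < node n ^ 2) : |a| < lam n :=
  abs_lt_of_sq_add_lt ha (lam_sq n) (lam_pos n)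

lemma sq_add_lt_node_sq {a : ℝ} {N n : ℕ} (ha : a ^ 2 + 9 / 16 < node N ^ 2) (h : N ≤ n) :
    a ^ 2 + 9 / 16 < node n ^ 2 :=
  ha.trans_le (pow_le_pow_left₀ (node_pos N).le (node_mono h) 2)

lemma lam_mono {m n : ℕ} (h : m ≤ n) : lam m ≤ lam n := by
  rw [lam_eq_sqrt, lam_eq_sqrt]
  exact Real.sqrt_le_sqrt (by linarith [pow_le_pow_left₀ (node_pos m).le (node_mono h) 2])

lemma signedPowerPair_of_abs_lt {a : ℝ} {n : ℕ} (h : |a| < lam n) (s : ℂ) :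
    signedPowerPair a n s = ((lam n + a : ℝ) : ℂ) ^ (-s) - ((lam n - a : ℝ) : ℂ) ^ (-s) := by
  have h1 := abs_lt.1 h
  have h2 : 0 < a + lam n := by linarith
  have h3 : a - lam n < 0 := by linarith
  rw [signedPowerPair, Real.sign_of_pos h2, Real.sign_of_neg h3, abs_of_pos h2, abs_of_neg h3,
    add_comm a, neg_sub]
  push_cast
  ring

lemma summable_prod_expansionCoeff {a : ℝ} {N : ℕ} (ha : a ^ 2 + 9 / 16 < node N ^ 2) {s : ℂ}
    (hs : 1 < s.re) :
    Summable fun p : ℕ × ℕ =>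
      expansionCoeff a p.1 s * (node (p.2 + N) : ℂ) ^ (-(s + (2 * p.1 + 1 : ℕ))) := by
  have h1 := summable_expansionCoeffBound (norm_nonneg s) (node_pos N) ha
  have h2 : Summable fun n => node (n + N) ^ (-(s.re + 1)) := by
    have h := (hasSum_nodeZeta N (z := s + 1) (by simp; linarith)).summable.norm
    convert! h using 2 with n
    rw [Complex.norm_cpow_eq_rpow_re_of_pos (node_pos _)]
    simp
  refine .of_norm_bounded (h1.mul_of_nonneg h2
    (fun m => mul_nonneg (expansionCoeffBound_nonneg _ _ _)
      (pow_nonneg (inv_nonneg.2 (node_pos N).le) _))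
    fun n => Real.rpow_nonneg (node_pos _).le _) fun p => ?_
  have hp := node_pos (p.2 + N)
  have hinv : (node (p.2 + N))⁻¹ ≤ (node N)⁻¹ := inv_anti₀ (node_pos N) (node_mono (by lia))
  have hexp : node (p.2 + N) ^ (-(s + (2 * p.1 + 1 : ℕ))).re =
      (node (p.2 + N))⁻¹ ^ (2 * p.1) * node (p.2 + N) ^ (-(s.re + 1)) := by
    rw [inv_pow, ← Real.rpow_natCast, ← Real.rpow_neg hp.le, ← Real.rpow_add hp]
    congr 1
    simp
    ring
  rw [norm_mul, Complex.norm_cpow_eq_rpow_re_of_pos hp, hexp, ← mul_assoc]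
  refine mul_le_mul_of_nonneg_right ?_ (Real.rpow_nonneg hp.le _)
  exact mul_le_mul (norm_expansionCoeff_le a le_rfl _)
    (pow_le_pow_left₀ (inv_nonneg.2 hp.le) hinv _) (by positivity)
    (expansionCoeffBound_nonneg _ _ _)

lemma hasSum_signedPowerPair {a : ℝ} {N : ℕ} (ha : a ^ 2 + 9 / 16 < node N ^ 2) {s : ℂ}
    (hs : 1 < s.re) :
    HasSum (fun n => signedPowerPair a n s)
      (∑ n ∈ Finset.range N, signedPowerPair a n s + zetaSeries a N ∅ s) := by
  rw [add_comm, ← hasSum_nat_add_iff]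
  have h := summable_prod_expansionCoeff ha hs
  have h1 (n : ℕ) : HasSum (fun m => expansionCoeff a m s *
      (node (n + N) : ℂ) ^ (-(s + (2 * m + 1 : ℕ)))) (signedPowerPair a (n + N) s) := by
    have hn := sq_add_lt_node_sq ha (Nat.le_add_left N n)
    rw [signedPowerPair_of_abs_lt (abs_lt_lam hn)]
    exact hasSum_expansionCoeff (node_pos _) hn (lam_sq _) (lam_pos _) s
  have h2 (m : ℕ) : HasSum (fun n => expansionCoeff a m s *
      (node (n + N) : ℂ) ^ (-(s + (2 * m + 1 : ℕ)))) (zetaTerm a N ∅ m s) := by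
    rw [zetaTerm, if_neg (Finset.notMem_empty m)]
    refine (hasSum_nodeZeta N ?_).mul_left _
    simp
    linarith [m.cast_nonneg (α := ℝ)]
  have h3 := h.hasSum.prod_fiberwise h2
  have h4 := ((Equiv.prodComm ℕ ℕ).hasSum_iff.2 h.hasSum).prod_fiberwise h1
  rw [zetaSeries, h3.tsum_eq]
  exact h4

lemma summable_sign_mul_cpow {a : ℝ} {N : ℕ} (ha : a ^ 2 + 9 / 16 < node N ^ 2) {s : ℂ}
    (hs : 1 < s.re) {x : ℕ → ℝ} (hx : ∀ n, lam n - |a| ≤ |x n|) :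
    Summable fun n => (Real.sign (x n) : ℂ) * ((|x n| : ℝ) : ℂ) ^ (-s) := by
  rw [← summable_nat_add_iff N]
  have haN := abs_lt_lam ha
  set δ : ℝ := 1 - |a| / lam N with hδ
  have hδ0 : 0 < δ := sub_pos.2 ((div_lt_one (lam_pos N)).2 haN)
  have h2 : Summable fun n => node (n + N) ^ (-s.re) := by
    convert! (hasSum_nodeZeta N hs).summable.norm using 2 with n
    rw [Complex.norm_cpow_eq_rpow_re_of_pos (node_pos _)]
    simp
  refine .of_norm_bounded (h2.mul_left (δ ^ (-s.re))) fun n => ?_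
  have h3 : node (n + N) ≤ lam (n + N) := by
    rw [lam_eq_sqrt]
    exact Real.le_sqrt_of_sq_le (by linarith)
  have h4 : δ * node (n + N) ≤ |x (n + N)| := by
    refine le_trans ?_ (hx _)
    refine (mul_le_mul_of_nonneg_left h3 hδ0.le).trans ?_
    have h5 : |a| ≤ |a| / lam N * lam (n + N) := by
      rw [div_mul_eq_mul_div, le_div_iff₀ (lam_pos N)]
      exact mul_le_mul_of_nonneg_left (lam_mono (by lia)) (abs_nonneg a)
    rw [hδ]
    linarith
  have h6 : 0 < δ * node (n + N) := mul_pos hδ0 (node_pos _)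
  have h7 : ‖(Real.sign (x (n + N)) : ℂ)‖ ≤ 1 := by
    rcases Real.sign_apply_eq (x (n + N)) with h | h | h <;> simp [h]
  rw [norm_mul, Complex.norm_cpow_eq_rpow_re_of_pos (h6.trans_le h4), Complex.neg_re,
    ← Real.mul_rpow hδ0.le (node_pos _).le]
  refine (mul_le_of_le_one_left (Real.rpow_nonneg (abs_nonneg _) _) h7).trans ?_
  exact Real.rpow_le_rpow_of_nonpos h6 h4 (by linarith)

lemma tsum_add_tsum_eq {a : ℝ} {N : ℕ} (ha : a ^ 2 + 9 / 16 < node N ^ 2) {s : ℂ}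
    (hs : 1 < s.re) :
    (∑' n : ℕ, (Real.sign (a + lam n) : ℂ) * ((|a + lam n| : ℝ) : ℂ) ^ (-s)) +
        (∑' n : ℕ, (Real.sign (a - lam n) : ℂ) * ((|a - lam n| : ℝ) : ℂ) ^ (-s)) =
      ∑ n ∈ Finset.range N, signedPowerPair a n s + zetaSeries a N ∅ s := by
  rw [← (hasSum_signedPowerPair ha hs).tsum_eq, ← Summable.tsum_add]
  · rfl
  · refine summable_sign_mul_cpow ha hs fun n => ?_
    linarith [neg_abs_le a, le_abs_self (a + lam n)]
  · refine summable_sign_mul_cpow ha hs fun n => ?_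
    linarith [le_abs_self a, neg_abs_le (a - lam n)]

lemma differentiable_signedPowerPair {a : ℝ} {n : ℕ} (h : |a| ≠ lam n) :
    Differentiable ℂ (signedPowerPair a n) := by
  have h1 : a + lam n ≠ 0 := fun h0 => h <| by
    rw [eq_neg_of_add_eq_zero_left h0, abs_neg, abs_of_pos (lam_pos n)]
  have h2 : a - lam n ≠ 0 := fun h0 => h <| by
    rw [sub_eq_zero.1 h0, abs_of_pos (lam_pos n)]
  exact ((differentiable_cpow_neg (abs_pos.2 h1)).const_mul _).add
    ((differentiable_cpow_neg (abs_pos.2 h2)).const_mul _)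

/-- The entire extension of `s * nodeZeta N (s + 1)`. -/
noncomputable def regularizedNodeZeta (N : ℕ) : ℂ → ℂ :=
  Function.update (fun s => s * nodeZeta N (s + 1)) 0 ((Real.sqrt 2 : ℝ) : ℂ)⁻¹

lemma regularizedNodeZeta_of_ne (N : ℕ) {s : ℂ} (hs : s ≠ 0) :
    regularizedNodeZeta N s = s * nodeZeta N (s + 1) :=
  Function.update_of_ne hs _ _

lemma tendsto_mul_nodeZeta (N : ℕ) (w : ℂ) :
    Tendsto (fun s => (s + w) * nodeZeta N (s + w + 1)) (𝓝[≠] (-w))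
      (𝓝 ((Real.sqrt 2 : ℝ) : ℂ)⁻¹) := by
  have h : Tendsto (fun s : ℂ => s + w + 1) (𝓝[≠] (-w)) (𝓝[≠] 1) := by
    refine tendsto_nhdsWithin_of_tendsto_nhds_of_eventually_within _ ?_ ?_
    · have : Continuous fun s : ℂ => s + w + 1 := by fun_prop
      simpa using this.tendsto (-w) |>.mono_left nhdsWithin_le_nhds
    · filter_upwards [self_mem_nhdsWithin] with s hs h1
      exact hs (eq_neg_of_add_eq_zero_left (by linear_combination Set.mem_singleton_iff.1 h1))
  refine ((nodeZeta_residue_one N).comp h).congr fun s => ?_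
  simp

lemma differentiable_regularizedNodeZeta (N : ℕ) : Differentiable ℂ (regularizedNodeZeta N) := by
  have hne {s : ℂ} (hs : s ≠ 0) : DifferentiableAt ℂ (regularizedNodeZeta N) s := by
    have h1 : DifferentiableAt ℂ (fun s => s * nodeZeta N (s + 1)) s := by
      refine differentiableAt_id.mul
        (DifferentiableAt.comp s (differentiableAt_nodeZeta N fun h => hs ?_) (by fun_prop))
      linear_combination h
    refine h1.congr_of_eventuallyEq ?_
    filter_upwards [isOpen_ne.mem_nhds hs] with w hw
    exact regularizedNodeZeta_of_ne N hw
  intro s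
  by_cases hs : s = 0
  · subst hs
    refine (Complex.analyticAt_of_differentiable_on_punctured_nhds_of_continuousAt
      ?_ ?_).differentiableAt
    · filter_upwards [self_mem_nhdsWithin] with w hw using hne hw
    · rw [regularizedNodeZeta, continuousAt_update_same]
      simpa using tendsto_mul_nodeZeta N 0
  · exact hne hs

/-- The meromorphic continuation of the eta function; the term of index `0` of `zetaSeries` is
replaced by its entire extension. -/
noncomputable def etaContinuation (a : ℝ) (N : ℕ) (s : ℂ) : ℂ :=
  ∑ n ∈ Finset.range N, signedPowerPair a n s + -(2 * a) * regularizedNodeZeta N s +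
    zetaSeries a N {0} s

lemma expansionCoeff_zero (a : ℝ) (s : ℂ) : expansionCoeff a 0 s = -(2 * a) * s := by
  simp [expansionCoeff, expansionTerm]
  ring

lemma etaContinuation_of_ne_zero {a : ℝ} {N : ℕ} (hN1 : 1 ≤ node N)
    (ha : a ^ 2 + 9 / 16 < node N ^ 2) {s : ℂ} (hs : s ≠ 0) :
    etaContinuation a N s =
      ∑ n ∈ Finset.range N, signedPowerPair a n s + zetaSeries a N ∅ s := by
  rw [etaContinuation, zetaSeries_eq_add_insert hN1 ha (Finset.notMem_empty 0),
    expansionCoeff_zero, regularizedNodeZeta_of_ne N hs]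
  simp
  ring

lemma differentiable_etaContinuation_regular_part {a : ℝ} (h : ∀ n, |a| ≠ lam n) (N : ℕ) :
    Differentiable ℂ fun s =>
      ∑ n ∈ Finset.range N, signedPowerPair a n s + -(2 * a) * regularizedNodeZeta N s :=
  (Differentiable.fun_sum fun n _ => differentiable_signedPowerPair (h n)).add
    ((differentiable_regularizedNodeZeta N).const_mul _)

lemma differentiableAt_etaContinuation {a : ℝ} (h : ∀ n, |a| ≠ lam n) {N : ℕ}
    (hN1 : 1 ≤ node N) (ha : a ^ 2 + 9 / 16 < node N ^ 2) {s : ℂ}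
    (hs : ∀ l : ℕ, 1 ≤ l → s ≠ -(2 * l : ℂ)) : DifferentiableAt ℂ (etaContinuation a N) s :=
  (differentiable_etaContinuation_regular_part h N s).add
    (differentiableAt_zetaSeries hN1 ha fun m hm => hs m
      (Nat.one_le_iff_ne_zero.2 (by simpa using hm)))

lemma tendsto_etaContinuation_residue {a : ℝ} (h : ∀ n, |a| ≠ lam n) {N : ℕ}
    (hN1 : 1 ≤ node N) (ha : a ^ 2 + 9 / 16 < node N ^ 2) {l : ℕ} (hl : 1 ≤ l) :
    Tendsto (fun s : ℂ => (s + (2 * l : ℂ)) * etaContinuation a N s) (𝓝[≠] (-(2 * l : ℂ)))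
      (𝓝 (expansionCoeff a l (-(2 * l)) * ((Real.sqrt 2 : ℝ) : ℂ)⁻¹)) := by
  have hl0 : l ∉ ({0} : Finset ℕ) := by simpa using Nat.one_le_iff_ne_zero.1 hl
  set R : ℂ → ℂ := fun s => (∑ n ∈ Finset.range N, signedPowerPair a n s +
    -(2 * a) * regularizedNodeZeta N s) + zetaSeries a N (insert l {0}) s with hR
  have hRd : DifferentiableAt ℂ R (-(2 * l)) := by
    refine (differentiable_etaContinuation_regular_part h N _).add
      (differentiableAt_zetaSeries hN1 ha fun m hm hml => hm ?_)
    have h1 : (2 * l : ℂ) = 2 * m := neg_injective hml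
    have h2 : 2 * l = 2 * m := by exact_mod_cast h1
    exact Finset.mem_insert.2 (Or.inl (by lia))
  have h1 : Tendsto (fun s : ℂ => (s + 2 * l) * R s) (𝓝[≠] (-(2 * l : ℂ)))
      (𝓝 ((-(2 * l) + 2 * l) * R (-(2 * l)))) := by
    refine Tendsto.mono_left ?_ nhdsWithin_le_nhds
    have : Continuous fun s : ℂ => s + 2 * l := by fun_prop
    exact (this.tendsto _).mul hRd.continuousAt
  have h2 : Tendsto (expansionCoeff a l) (𝓝[≠] (-(2 * l : ℂ)))
      (𝓝 (expansionCoeff a l (-(2 * l)))) :=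
    ((differentiable_expansionCoeff a l).continuous.tendsto _).mono_left nhdsWithin_le_nhds
  convert! (h2.mul (tendsto_mul_nodeZeta N (2 * l))).add h1 using 1
  · ext s
    rw [etaContinuation, zetaSeries_eq_add_insert hN1 ha hl0, hR]
    push_cast
    ring_nf
  · simp

lemma ring_choose_sub_half (k : ℕ) :
    Ring.choose ((k : ℂ) - 1 / 2) k = (Nat.choose (2 * k) k : ℂ) / 4 ^ k := by
  have h1 : ∏ i ∈ Finset.range k, ((k : ℂ) - 1 / 2 - i) =
      ∏ i ∈ Finset.range k, ((i : ℂ) + 1 / 2) := by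
    rw [← Finset.prod_range_reflect]
    refine Finset.prod_congr rfl fun i hi => ?_
    have h2 : k - 1 - i + (i + 1) = k := by have := Finset.mem_range.1 hi; lia
    have h3 : (k : ℂ) = (k - 1 - i : ℕ) + (i + 1) := by
      rw [← h2]; push_cast; simp [h2]
    rw [h3]
    ring
  rw [ring_choose_eq_prod, h1, ← Nat.centralBinom_eq_two_mul_choose]
  clear h1
  induction k with
  | zero => simp
  | succ k ih =>
    have h4 : ((k : ℂ) + 1) * (k + 1).centralBinom = 2 * (2 * k + 1) * k.centralBinom := by
      exact_mod_cast Nat.succ_mul_centralBinom_succ k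
    have h5 : (k : ℂ) + 1 ≠ 0 := Nat.cast_add_one_ne_zero k
    have h6 : (k.factorial : ℂ) ≠ 0 := by exact_mod_cast k.factorial_ne_zero
    rw [div_eq_div_iff h6 (pow_ne_zero k (by norm_num))] at ih
    rw [Finset.prod_range_succ, Nat.factorial_succ, div_eq_div_iff
      (by exact_mod_cast (mul_ne_zero k.succ_ne_zero k.factorial_ne_zero))
      (pow_ne_zero _ (by norm_num))]
    push_cast
    rw [pow_succ]
    linear_combination 4 * ((k : ℂ) + 1 / 2) * ih - (k.factorial : ℂ) * h4

lemma two_mul_inv_sqrt_two : 2 * ((Real.sqrt 2 : ℝ) : ℂ)⁻¹ = (Real.sqrt 2 : ℂ) := by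
  have h0 : ((Real.sqrt 2 : ℝ) : ℂ) ≠ 0 := by
    exact_mod_cast (Real.sqrt_pos.2 two_pos).ne'
  rw [← div_eq_mul_inv, div_eq_iff h0, ← Complex.ofReal_mul, Real.mul_self_sqrt zero_le_two]
  simp

lemma expansionCoeff_neg_two_mul (a : ℝ) (l : ℕ) :
    expansionCoeff a l (-(2 * l)) * ((Real.sqrt 2 : ℝ) : ℂ)⁻¹ =
      (Real.sqrt 2 : ℂ) * ∑ j ∈ Finset.range l,
        (Nat.choose (2 * l) (2 * j + 1) : ℂ) * (Nat.choose (2 * l - 2 * j) (l - j) : ℂ) *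
          ((9 : ℂ) / 64) ^ (l - j) * (a : ℂ) ^ (2 * j + 1) := by
  have hchoose (i : ℕ) : Ring.choose (2 * l : ℂ) i = (Nat.choose (2 * l) i : ℂ) := by
    rw [← Ring.choose_natCast]
    push_cast
    rfl
  rw [expansionCoeff, Finset.Nat.sum_antidiagonal_eq_sum_range_succ_mk, Finset.sum_range_succ,
    Finset.mul_sum]
  have hlast : expansionTerm a (-(2 * l)) l (l - l) = 0 := by
    rw [expansionTerm, neg_neg, hchoose, Nat.choose_eq_zero_of_lt (by lia)]
    simp
  rw [hlast, add_zero, Finset.sum_mul]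
  refine Finset.sum_congr rfl fun j hj => ?_
  obtain ⟨k, rfl⟩ := Nat.exists_eq_add_of_le (Finset.mem_range.1 hj).le
  have hhalf : -((-(2 * ((j + k : ℕ) : ℂ)) + (2 * j + 1)) / 2) = (k : ℂ) - 1 / 2 := by
    push_cast
    ring
  have h64 : (9 / 16 : ℂ) ^ k / 4 ^ k = (9 / 64) ^ k := by
    rw [← div_pow]
    norm_num
  simp only [expansionTerm]
  rw [neg_neg, hchoose, Nat.add_sub_cancel_left, hhalf, ring_choose_sub_half, ← Nat.mul_sub,
    Nat.add_sub_cancel_left, ← h64]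
  linear_combination (Nat.choose (2 * (j + k)) (2 * j + 1) : ℂ) * (Nat.choose (2 * k) k : ℂ) *
    ((9 / 16 : ℂ) ^ k / 4 ^ k) * (a : ℂ) ^ (2 * j + 1) * two_mul_inv_sqrt_two

lemma sign_add_sign (a : ℝ) {l : ℝ} (hl : 0 < l) (h : |a| ≠ l) :
    Real.sign (a + l) + Real.sign (a - l) = if l < |a| then 2 * Real.sign a else 0 := by
  split_ifs with h1
  · rcases lt_or_ge a 0 with h0 | h0
    · rw [abs_of_neg h0] at h1
      rw [Real.sign_of_neg h0, Real.sign_of_neg (by linarith), Real.sign_of_neg (by linarith)]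
      ring
    · rw [abs_of_nonneg h0] at h1
      rw [Real.sign_of_pos (by linarith), Real.sign_of_pos (by linarith),
        Real.sign_of_pos (by linarith)]
      ring
  · have h2 := abs_lt.1 (lt_of_le_of_ne (not_lt.1 h1) h)
    rw [Real.sign_of_pos (by linarith), Real.sign_of_neg (by linarith)]
    ring

lemma expansionCoeff_apply_zero (a : ℝ) (m : ℕ) : expansionCoeff a m 0 = 0 := by
  refine Finset.sum_eq_zero fun p _ => ?_
  rw [expansionTerm, neg_zero, Ring.choose_zero_succ]
  simp

lemma etaContinuation_zero {a : ℝ} (h : ∀ n, |a| ≠ lam n) {N : ℕ}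
    (ha : a ^ 2 + 9 / 16 < node N ^ 2) :
    etaContinuation a N 0 = 2 * (Real.sign a : ℂ) * (Set.ncard {n : ℕ | lam n < |a|} : ℂ)
      - (Real.sqrt 2 : ℂ) * (a : ℂ) := by
  have hseries : zetaSeries a N {0} 0 = 0 := by
    refine (tsum_congr fun m => ?_).trans tsum_zero
    rw [zetaTerm, expansionCoeff_apply_zero]
    simp
  have hpair (n : ℕ) : signedPowerPair a n 0 =
      if lam n < |a| then 2 * (Real.sign a : ℂ) else 0 := by
    have h1 := sign_add_sign a (lam_pos n) (h n)
    rw [signedPowerPair, neg_zero, Complex.cpow_zero, Complex.cpow_zero, mul_one, mul_one,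
      ← Complex.ofReal_add, h1]
    split_ifs <;> simp
  have hset : {n : ℕ | lam n < |a|} = ((Finset.range N).filter fun n => lam n < |a| : Finset ℕ) := by
    ext n
    simp only [Set.mem_ofPred_eq, Finset.coe_filter, Finset.mem_range, iff_and_self]
    intro hn
    by_contra! hNn
    exact lt_asymm hn ((abs_lt_lam ha).trans_le (lam_mono hNn))
  rw [etaContinuation, hseries, regularizedNodeZeta, Function.update_self, hset,
    Set.ncard_coe_finset, Finset.sum_congr rfl fun n _ => hpair n, ← Finset.sum_filter,
    Finset.sum_const, nsmul_eq_mul]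
  linear_combination -(a : ℂ) * two_mul_inv_sqrt_two

lemma sum_choose_odd {R : Type*} [CommRing R] (x y : R) (l : ℕ) :
    ∑ j ∈ Finset.range (l + 1), 2 * (Nat.choose (2 * l + 1) (2 * j + 1) : R) * x ^ (2 * j + 1) *
      (y ^ 2) ^ (l - j) = (x + y) ^ (2 * l + 1) + (x - y) ^ (2 * l + 1) := by
  have hsplit (g : ℕ → R) (m : ℕ) : ∑ i ∈ Finset.range (2 * m), g i =
      ∑ j ∈ Finset.range m, (g (2 * j) + g (2 * j + 1)) := by
    induction m with
    | zero => simp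
    | succ m ih =>
      rw [mul_add, mul_one, Finset.sum_range_succ, Finset.sum_range_succ, ih,
        Finset.sum_range_succ]
      ring
  rw [sub_eq_add_neg x y, add_pow, add_pow, ← Finset.sum_add_distrib,
    show 2 * l + 1 + 1 = 2 * (l + 1) by ring, hsplit]
  refine Finset.sum_congr rfl fun j hj => ?_
  obtain ⟨k, rfl⟩ := Nat.exists_eq_add_of_le (Nat.lt_succ_iff.1 (Finset.mem_range.1 hj))
  have h1 : 2 * (j + k) + 1 - 2 * j = 2 * k + 1 := by lia
  have h2 : 2 * (j + k) + 1 - (2 * j + 1) = 2 * k := by lia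
  rw [h1, h2, Nat.add_sub_cancel_left, Odd.neg_pow ⟨k, rfl⟩, Even.neg_pow ⟨k, by ring⟩, ← pow_mul]
  ring

lemma sign_mul_abs_cpow (x : ℝ) (l : ℕ) :
    (Real.sign x : ℂ) * ((|x| : ℝ) : ℂ) ^ (-(-(2 * l + 1 : ℂ))) = (x : ℂ) ^ (2 * l + 1) := by
  have h1 : (-(-(2 * l + 1 : ℂ))) = ((2 * l + 1 : ℕ) : ℂ) := by push_cast; ring
  have h2 : Odd (2 * l + 1) := ⟨l, rfl⟩
  rw [h1, Complex.cpow_natCast, ← Complex.ofReal_pow, ← Complex.ofReal_pow, ← Complex.ofReal_mul]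
  congr 1
  rcases lt_trichotomy x 0 with h | rfl | h
  · rw [Real.sign_of_neg h, abs_of_neg h, h2.neg_pow]
    ring
  · simp
  · rw [Real.sign_of_pos h, abs_of_pos h, one_mul]

lemma expansionTerm_neg_odd (a : ℝ) (l : ℕ) {j : ℕ} (hj : j ≤ l) (k : ℕ) :
    expansionTerm a (-(2 * l + 1)) j k =
      2 * (Nat.choose (2 * l + 1) (2 * j + 1) : ℂ) * (a : ℂ) ^ (2 * j + 1) *
        ((9 / 16) ^ k * (Nat.choose (l - j) k : ℂ)) := by
  obtain ⟨i, rfl⟩ := Nat.exists_eq_add_of_le hj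
  have h1 : -(-(2 * ((j + i : ℕ) : ℂ) + 1)) = ((2 * (j + i) + 1 : ℕ) : ℂ) := by
    push_cast
    ring
  have h2 : -((-(2 * ((j + i : ℕ) : ℂ) + 1) + (2 * j + 1)) / 2) = (i : ℂ) := by
    push_cast
    ring
  rw [expansionTerm, h1, h2, Ring.choose_natCast, Ring.choose_natCast, Nat.add_sub_cancel_left]
  ring

lemma expansionTerm_neg_odd_of_lt (a : ℝ) {l j k : ℕ} (h : l < j + k) :
    expansionTerm a (-(2 * l + 1)) j k = 0 := by
  rcases le_or_gt j l with hj | hj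
  · rw [expansionTerm_neg_odd a l hj, Nat.choose_eq_zero_of_lt (by lia : l - j < k)]
    simp
  · have h1 : -(-(2 * (l : ℂ) + 1)) = ((2 * l + 1 : ℕ) : ℂ) := by
      push_cast
      ring
    rw [expansionTerm, h1, Ring.choose_natCast, Nat.choose_eq_zero_of_lt (by lia)]
    simp

lemma sum_expansionCoeff_neg_odd (a : ℝ) (l n : ℕ) :
    ∑ m ∈ Finset.range (l + 1), expansionCoeff a m (-(2 * l + 1)) *
      (node n : ℂ) ^ (2 * (l - m)) = signedPowerPair a n (-(2 * l + 1)) := by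
  have hlam : ((lam n : ℝ) : ℂ) ^ 2 = 9 / 16 + (node n : ℂ) ^ 2 := by
    rw [← Complex.ofReal_pow, lam_sq]
    push_cast
    ring
  have h1 (m : ℕ) (hm : m ∈ Finset.range (l + 1)) :
      expansionCoeff a m (-(2 * l + 1)) * (node n : ℂ) ^ (2 * (l - m)) =
      ∑ j ∈ Finset.range (m + 1), expansionTerm a (-(2 * l + 1)) j (m - j) *
        ((node n : ℂ) ^ 2) ^ (l - j - (m - j)) := by
    rw [expansionCoeff, Finset.Nat.sum_antidiagonal_eq_sum_range_succ_mk, Finset.sum_mul]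
    refine Finset.sum_congr rfl fun j hj => ?_
    rw [← pow_mul]
    have := Finset.mem_range.1 hj
    congr 3
    lia
  rw [Finset.sum_congr rfl h1, Finset.sum_range_diag_flip (l + 1) fun j k =>
    expansionTerm a (-(2 * l + 1)) j k * ((node n : ℂ) ^ 2) ^ (l - j - k)]
  rw [signedPowerPair, sign_mul_abs_cpow, sign_mul_abs_cpow, Complex.ofReal_add,
    Complex.ofReal_sub, ← sum_choose_odd]
  refine Finset.sum_congr rfl fun j hj => ?_
  have hjl : j ≤ l := Nat.lt_succ_iff.1 (Finset.mem_range.1 hj)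
  rw [hlam, add_pow, Finset.mul_sum, Nat.succ_sub hjl]
  refine Finset.sum_congr rfl fun k _ => ?_
  rw [expansionTerm_neg_odd a l hjl]
  ring

lemma etaContinuation_neg_odd {a : ℝ} {N : ℕ} (hN1 : 1 ≤ node N)
    (ha : a ^ 2 + 9 / 16 < node N ^ 2) (l : ℕ) : etaContinuation a N (-(2 * l + 1)) = 0 := by
  have hs : (-(2 * l + 1) : ℂ) ≠ 0 := by
    rw [neg_ne_zero]
    exact_mod_cast (2 * l).succ_ne_zero
  have hcoeff {m : ℕ} (hm : l < m) : expansionCoeff a m (-(2 * l + 1)) = 0 :=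
    Finset.sum_eq_zero fun p hp => expansionTerm_neg_odd_of_lt a <| by
      rwa [Finset.HasAntidiagonal.mem_antidiagonal.1 hp]
  have hseries : zetaSeries a N ∅ (-(2 * l + 1)) = ∑ m ∈ Finset.range (l + 1),
      expansionCoeff a m (-(2 * l + 1)) *
        -∑ n ∈ Finset.range N, (node n : ℂ) ^ (2 * (l - m)) := by
    rw [zetaSeries, tsum_eq_sum (s := Finset.range (l + 1)) fun m hm => by
      rw [zetaTerm, hcoeff (by simpa using hm), zero_mul, ite_self]]
    refine Finset.sum_congr rfl fun m hm => ?_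
    have hml : m ≤ l := Nat.lt_succ_iff.1 (Finset.mem_range.1 hm)
    have harg : (-(2 * l + 1) + (2 * m + 1 : ℕ) : ℂ) = -(2 * (l - m : ℕ)) := by
      push_cast [hml]
      ring
    rw [zetaTerm, if_neg (Finset.notMem_empty m), harg, nodeZeta_neg_two_mul]
  rw [etaContinuation_of_ne_zero hN1 ha hs, hseries,
    Finset.sum_congr rfl fun n _ => (sum_expansionCoeff_neg_odd a l n).symm, Finset.sum_comm]
  simp_rw [mul_neg, Finset.mul_sum, Finset.sum_neg_distrib]
  exact add_neg_cancel _

lemma exists_node_gt (a : ℝ) : ∃ N : ℕ, 1 ≤ node N ∧ a ^ 2 + 9 / 16 < node N ^ 2 := by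
  obtain ⟨N, hN⟩ := exists_nat_ge (a ^ 2 + 1)
  have h1 : (N : ℝ) ≤ node N := by
    have h2 : 1 ≤ Real.sqrt 2 := Real.one_le_sqrt.2 one_le_two
    unfold node
    nlinarith [N.cast_nonneg (α := ℝ)]
  have h3 : a ^ 2 + 1 ≤ node N := hN.trans h1
  exact ⟨N, by nlinarith [sq_nonneg a], by nlinarith [sq_nonneg a]⟩

/-- Meromorphic continuation of the eta function `η̃(s,a)`: it is holomorphic away from the
negative even integers, agrees with the defining series for `Re s > 1`, has at most simple
poles at `s = -2l` (`l ≥ 1`) with the stated residues, and has the stated special values at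
`s = 0` and at the negative odd integers. -/
theorem eta_tilde_continuation (a : ℝ) (ha : ∀ n : ℕ, |a| ≠ lam n) :
    ∃ F : ℂ → ℂ,
      (∀ s : ℂ, (∀ l : ℕ, 1 ≤ l → s ≠ -(2 * l : ℂ)) → DifferentiableAt ℂ F s) ∧
      (∀ s : ℂ, 1 < s.re →
        F s = (∑' n : ℕ, (Real.sign (a + lam n) : ℂ) * ((|a + lam n| : ℝ) : ℂ) ^ (-s))
            + (∑' n : ℕ, (Real.sign (a - lam n) : ℂ) * ((|a - lam n| : ℝ) : ℂ) ^ (-s))) ∧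
      (∀ l : ℕ, 1 ≤ l →
        Tendsto (fun s : ℂ => (s + (2 * l : ℂ)) * F s) (𝓝[≠] (-(2 * l : ℂ)))
          (𝓝 ((Real.sqrt 2 : ℂ) *
            ∑ j ∈ Finset.range l,
              (Nat.choose (2 * l) (2 * j + 1) : ℂ) * (Nat.choose (2 * l - 2 * j) (l - j) : ℂ) *
                ((9 : ℂ) / 64) ^ (l - j) * (a : ℂ) ^ (2 * j + 1)))) ∧
      (F 0 = 2 * (Real.sign a : ℂ) * (Set.ncard {n : ℕ | lam n < |a|} : ℂ)
               - (Real.sqrt 2 : ℂ) * (a : ℂ)) ∧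
      (∀ l : ℕ, F (-(2 * l + 1 : ℂ)) = 0) := by
  obtain ⟨N, hN1, hN⟩ := exists_node_gt a
  refine ⟨etaContinuation a N, fun s hs => differentiableAt_etaContinuation ha hN1 hN hs,
    fun s hs => ?_, fun l hl => ?_, etaContinuation_zero ha hN,
    etaContinuation_neg_odd hN1 hN⟩
  · rw [etaContinuation_of_ne_zero hN1 hN (fun h => by simp [h] at hs; linarith),
      tsum_add_tsum_eq hN hs]
  · rw [← expansionCoeff_neg_two_mul]
    exact tendsto_etaContinuation_residue ha hN1 hN hl
end

section
/- Let a be a real number with 0 < a < 1 and let l ∈ ℕ. Then the function s ↦ ζ_H(s, a) − ζ_H(s, 1−a) is complex differentiable at s = −(2l+1), and its derivative there equals (−1)^l·(2π)^{−(2l+1)}·(2l+1)!·Im( ∑_{n=1}^∞ e^{2πina}/n^{2l+2} ) (a real number, viewed as a complex number). -/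
open Real Complex HurwitzZeta

/-- The even parts of the Hurwitz zeta function cancel in the antisymmetrization. -/
lemma hurwitzZeta_sub_hurwitzZeta_neg (a : UnitAddCircle) (s : ℂ) :
    hurwitzZeta a s - hurwitzZeta (-a) s = 2 * hurwitzZetaOdd a s := by
  simp only [hurwitzZeta, hurwitzZetaEven_neg, hurwitzZetaOdd_neg]
  ring

lemma coe_one_sub_unitAddCircle (a : ℝ) :
    ((1 - a : ℝ) : UnitAddCircle) = -(a : UnitAddCircle) := by
  rw [AddCircle.coe_sub, AddCircle.coe_period, zero_sub]

/-- At integers `k ≥ 2`, `sinZeta` is the imaginary part of the polylogarithm. -/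
lemma sinZeta_natCast_eq_im_tsum (a : ℝ) {k : ℕ} (hk : 2 ≤ k) :
    sinZeta (a : UnitAddCircle) (k : ℂ) =
      ((∑' n : ℕ+, Complex.exp (2 * Real.pi * Complex.I * (n : ℂ) * (a : ℂ)) /
        (n : ℂ) ^ k).im : ℝ) := by
  have hs : 1 < (k : ℂ).re := by
    rw [natCast_re]
    exact_mod_cast hk
  have hE := hasSum_expZeta_of_one_lt_re a hs
  have hS := hasSum_nat_sinZeta a hs
  have hk0 : k ≠ 0 := by lia
  have htsum : (∑' n : ℕ+, Complex.exp (2 * Real.pi * Complex.I * (n : ℂ) * (a : ℂ)) /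
      (n : ℂ) ^ k) = expZeta a k := by
    have hsupp : Function.support (fun n : ℕ ↦
        Complex.exp (2 * Real.pi * Complex.I * a * n) / (n : ℂ) ^ (k : ℂ)) ⊆
        Set.range ((↑) : ℕ+ → ℕ) := fun n hn ↦ by
      rcases Nat.eq_zero_or_pos n with rfl | h
      · simp [hk0] at hn
      · exact ⟨⟨n, h⟩, rfl⟩
    rw [← hE.tsum_eq, ← PNat.coe_injective.tsum_eq hsupp]
    refine tsum_congr fun n ↦ ?_
    rw [cpow_natCast]
    congr 2
    ring
  rw [htsum]
  have hI := Complex.hasSum_ofReal.mpr (Complex.hasSum_im hE)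
  refine hS.unique (hI.congr_fun fun n ↦ ?_)
  have h1 : (2 * Real.pi * Complex.I * a * n : ℂ) = ((2 * Real.pi * a * n : ℝ) : ℂ) * Complex.I := by
    push_cast
    ring
  rw [h1, cpow_natCast, ← Nat.cast_pow, ← ofReal_natCast, Complex.div_ofReal_im,
    Complex.exp_ofReal_mul_I_im]
  push_cast
  rfl

/-- The derivative of the odd Hurwitz zeta function at its trivial zeros. -/
lemma hasDerivAt_hurwitzZetaOdd_neg_odd (a : UnitAddCircle) (l : ℕ) :
    HasDerivAt (hurwitzZetaOdd a)
      ((-1) ^ l * Real.pi * (2 * Real.pi) ^ (-(2 * (l : ℤ) + 2)) * (Nat.factorial (2 * l + 1)) *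
        sinZeta a ((2 * l + 2 : ℕ) : ℂ)) (-(2 * l + 1 : ℂ)) := by
  set s₀ : ℂ := -(2 * l + 1 : ℂ) with hs₀
  have hone : 1 - s₀ = ((2 * l + 2 : ℕ) : ℂ) := by
    rw [hs₀]
    push_cast
    ring
  have hsub : DifferentiableAt ℂ (fun s : ℂ ↦ 1 - s) s₀ := by fun_prop
  have hcpow : DifferentiableAt ℂ (fun s : ℂ ↦ (2 * Real.pi : ℂ) ^ (-(1 - s))) s₀ :=
    hsub.neg.const_cpow (Or.inl (by simp [Real.pi_ne_zero]))
  have hΓ : DifferentiableAt ℂ (fun s : ℂ ↦ Complex.Gamma (1 - s)) s₀ := by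
    refine (differentiableAt_Gamma _ fun m ↦ ?_).comp s₀ hsub
    rw [hone]
    intro h
    have := congrArg Complex.re h
    simp only [natCast_re, neg_re] at this
    have h2 : (0 : ℝ) < ((2 * l + 2 : ℕ) : ℝ) := by positivity
    have h3 : (0 : ℝ) ≤ m := by positivity
    linarith
  have hsinZeta : DifferentiableAt ℂ (fun s : ℂ ↦ sinZeta a (1 - s)) s₀ :=
    ((differentiableAt_sinZeta a) (1 - s₀)).comp s₀ hsub
  have hG := ((((hcpow.const_mul 2).mul hΓ).mul hsinZeta)).hasDerivAt
  have hangle : (Real.pi : ℂ) * (1 - s₀) / 2 = ((l + 1 : ℕ) : ℂ) * Real.pi := by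
    rw [hone]
    push_cast
    ring
  have hsin : HasDerivAt (fun s : ℂ ↦ Complex.sin (Real.pi * (1 - s) / 2))
      (Complex.cos (Real.pi * (1 - s₀) / 2) * (Real.pi * (-1) / 2)) s₀ :=
    ((((hasDerivAt_id s₀).const_sub 1).const_mul (Real.pi : ℂ)).div_const 2).csin
  have hcos : Complex.cos (Real.pi * (1 - s₀) / 2) = (-1) ^ (l + 1) := by
    rw [hangle]
    exact_mod_cast congrArg ((↑) : ℝ → ℂ) (Real.cos_nat_mul_pi (l + 1))
  have hsin0 : Complex.sin (Real.pi * (1 - s₀) / 2) = 0 := by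
    rw [hangle, Complex.sin_nat_mul_pi]
  have hprod := hG.mul hsin
  have heq : hurwitzZetaOdd a =ᶠ[nhds s₀] fun s ↦ (2 * (2 * Real.pi : ℂ) ^ (-(1 - s)) *
      Complex.Gamma (1 - s) * sinZeta a (1 - s)) * Complex.sin (Real.pi * (1 - s) / 2) := by
    have hre : s₀.re < 1 := by
      have : s₀.re = -(2 * l + 1 : ℝ) := by simp [hs₀]
      rw [this]
      have : (0 : ℝ) ≤ l := by positivity
      linarith
    filter_upwards [(isOpen_lt continuous_re continuous_const).mem_nhds hre] with s hs
    have hs' : s.re < 1 := hs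
    have := hurwitzZetaOdd_one_sub a (s := 1 - s) fun n h ↦ by
      have := congrArg Complex.re h
      simp only [sub_re, one_re, neg_re, natCast_re] at this
      have h3 : (0 : ℝ) ≤ n := by positivity
      linarith
    rw [sub_sub_cancel] at this
    rw [this]
    ring
  refine (hprod.congr_of_eventuallyEq heq).congr_deriv ?_
  have hΓv : Complex.Gamma ((2 * l + 2 : ℕ) : ℂ) = Nat.factorial (2 * l + 1) := by
    rw [← Complex.Gamma_nat_eq_factorial]
    push_cast
    ring_nf
  have hpow : (2 * Real.pi : ℂ) ^ (-((2 * l + 2 : ℕ) : ℂ)) =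
      (2 * Real.pi) ^ (-(2 * (l : ℤ) + 2)) := by
    rw [← cpow_intCast]
    push_cast
    rfl
  rw [hsin0, hcos]
  simp only [Pi.mul_apply, hone, hΓv, hpow, mul_zero, zero_add]
  ring


open Real Complex HurwitzZeta

/-- For `0 < a < 1` and `l ∈ ℕ`, the function `s ↦ ζ_H(s,a) - ζ_H(s,1-a)` is differentiable
at `s = -(2l+1)` and its derivative there equals
`(-1)^l (2π)^{-(2l+1)} (2l+1)! · Im(Li_{2l+2}(e^{2πia}))`. -/
theorem deriv_hurwitzZeta_sub_at_neg_odd (a : ℝ) (ha₀ : 0 < a) (ha₁ : a < 1) (l : ℕ) :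
    DifferentiableAt ℂ
      (fun s : ℂ => hurwitzZeta (a : UnitAddCircle) s
        - hurwitzZeta ((1 - a : ℝ) : UnitAddCircle) s) (-(2 * l + 1 : ℂ)) ∧
    deriv (fun s : ℂ => hurwitzZeta (a : UnitAddCircle) s
        - hurwitzZeta ((1 - a : ℝ) : UnitAddCircle) s) (-(2 * l + 1 : ℂ))
      = (((-1 : ℝ) ^ l * (2 * Real.pi) ^ (-(2 * (l : ℤ) + 1)) * (Nat.factorial (2 * l + 1)) *
          (∑' n : ℕ+, Complex.exp (2 * Real.pi * Complex.I * (n : ℂ) * (a : ℂ))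
            / (n : ℂ) ^ (2 * l + 2)).im : ℝ) : ℂ) := by
  have hfun : (fun s : ℂ => hurwitzZeta (a : UnitAddCircle) s
      - hurwitzZeta ((1 - a : ℝ) : UnitAddCircle) s) =
      fun s ↦ 2 * hurwitzZetaOdd (a : UnitAddCircle) s := by
    funext s
    rw [coe_one_sub_unitAddCircle, hurwitzZeta_sub_hurwitzZeta_neg]
  rw [hfun]
  have h := (hasDerivAt_hurwitzZetaOdd_neg_odd (a : UnitAddCircle) l).const_mul 2
  refine ⟨h.differentiableAt, ?_⟩
  rw [h.deriv, sinZeta_natCast_eq_im_tsum a (by lia : 2 ≤ 2 * l + 2)]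
  have h2π : (2 * Real.pi : ℂ) ≠ 0 := by simp [Real.pi_ne_zero]
  have hz : (2 * Real.pi : ℂ) ^ (-(2 * (l : ℤ) + 1)) =
      (2 * Real.pi : ℂ) ^ (-(2 * (l : ℤ) + 2)) * (2 * Real.pi) := by
    rw [← zpow_add_one₀ h2π]
    congr 1
  simp only [ofReal_mul, ofReal_pow, ofReal_neg, ofReal_one, ofReal_zpow, ofReal_ofNat,
    ofReal_natCast, hz]
  ring
end

section
/- Let a be a real number with a ∉ ℤ and let l ∈ ℕ. Then the function x ↦ x^{2l+1}·e^x / (e^{2x} − 2·e^x·cos(2πa) + 1) is integrable on (0, ∞) and (2l+1)! · ∑_{n=1}^∞ sin(2πna)/n^{2l+2} = sin(2πa) · ∫_0^∞ x^{2l+1}·e^x / (e^{2x} − 2·e^x·cos(2πa) + 1) dx. -/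
open Real MeasureTheory

/-- The denominator `|exp x - exp (iθ)|²`, written as a convex combination of squares, is bounded
below by a multiple of `exp (2 * x)`. -/
lemma exp_sq_le_exp_sub_cos (x θ : ℝ) :
    (1 - cos θ) / 2 * exp x ^ 2 ≤ exp (2 * x) - 2 * exp x * cos θ + 1 := by
  have h2 : exp (2 * x) = exp x ^ 2 := by rw [← Real.exp_nat_mul]; norm_num
  rw [h2]
  nlinarith [mul_nonneg (by linarith [neg_one_le_cos θ] : 0 ≤ 1 + cos θ) (sq_nonneg (exp x - 1)),
    mul_nonneg (sub_nonneg.2 (cos_le_one θ)) (exp_pos x).le, cos_le_one θ]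

lemma hasSum_sin_mul_exp_neg {x : ℝ} (hx : 0 < x) (θ : ℝ) :
    HasSum (fun n : ℕ => sin ((n + 1 : ℝ) * θ) * exp (-((n + 1 : ℝ) * x)))
      (sin θ * exp x / (exp (2 * x) - 2 * exp x * cos θ + 1)) := by
  set z : ℂ := Complex.exp (⟨-x, θ⟩ : ℂ) with hz
  have hnorm : ‖z‖ < 1 := by
    rw [hz, Complex.norm_exp]
    simpa using hx
  have hs := Complex.hasSum_im ((hasSum_geometric_of_norm_lt_one hnorm).mul_left z)
  have hre : z.re = exp (-x) * cos θ := by rw [hz, Complex.exp_re]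
  have him : z.im = exp (-x) * sin θ := by rw [hz, Complex.exp_im]
  convert! hs using 1
  · ext n
    have hp : z * z ^ n = Complex.exp (((n + 1 : ℕ) : ℂ) * ⟨-x, θ⟩) := by
      rw [Complex.exp_nat_mul, pow_succ']
    rw [hp, Complex.exp_im, ← Complex.ofReal_natCast, Complex.re_ofReal_mul,
      Complex.im_ofReal_mul]
    push_cast
    ring_nf
  · have h2 : exp (2 * x) = exp x ^ 2 := by rw [← Real.exp_nat_mul]; norm_num
    have hy : 1 < exp x := one_lt_exp_iff.2 hx
    have hD : exp x ^ 2 - 2 * exp x * cos θ + 1 ≠ 0 := by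
      nlinarith [mul_nonneg (sub_nonneg.2 (cos_le_one θ)) (exp_pos x).le]
    have hN : Complex.normSq (1 - z) = (exp x ^ 2 - 2 * exp x * cos θ + 1) / exp x ^ 2 := by
      rw [Complex.normSq_apply, Complex.sub_re, Complex.sub_im, hre, him, exp_neg,
        Complex.one_re, Complex.one_im]
      field_simp
      linear_combination sin_sq_add_cos_sq θ
    rw [Complex.mul_im, Complex.inv_re, Complex.inv_im, hN, Complex.sub_re, Complex.sub_im, hre,
      him, exp_neg, Complex.one_re, Complex.one_im, h2]
    field_simp
    ring

lemma integrableOn_pow_mul_exp_neg_mul (m : ℕ) {r : ℝ} (hr : 0 < r) :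
    IntegrableOn (fun x : ℝ => x ^ m * exp (-(r * x))) (Set.Ioi 0) := by
  simpa using integrableOn_rpow_mul_exp_neg_mul_rpow (s := m) (p := 1) (b := r)
    (by linarith [m.cast_nonneg (α := ℝ)]) one_pos hr

lemma integral_pow_mul_exp_neg_mul (m : ℕ) {r : ℝ} (hr : 0 < r) :
    ∫ x in Set.Ioi (0 : ℝ), x ^ m * exp (-(r * x)) = m.factorial / r ^ (m + 1) := by
  have h := integral_rpow_mul_exp_neg_mul_Ioi (a := (m : ℝ) + 1) (by positivity) hr
  rw [Real.Gamma_nat_eq_factorial] at h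
  simp only [add_sub_cancel_right, rpow_natCast] at h
  rw [h, ← Nat.cast_add_one, rpow_natCast]
  simp [div_eq_inv_mul]

lemma integrableOn_pow_mul_exp_div (m : ℕ) {θ : ℝ} (hθ : cos θ < 1) :
    IntegrableOn (fun x : ℝ => x ^ m * exp x / (exp (2 * x) - 2 * exp x * cos θ + 1))
      (Set.Ioi 0) := by
  refine Integrable.mono' ((integrableOn_pow_mul_exp_neg_mul m one_pos).const_mul
    (2 / (1 - cos θ))) (by fun_prop : Measurable _).aestronglyMeasurable ?_
  refine (ae_restrict_iff' measurableSet_Ioi).2 (.of_forall fun x (hx : 0 < x) => ?_)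
  have hc : 0 < 1 - cos θ := sub_pos.2 hθ
  have hlow : 0 < (1 - cos θ) / 2 * exp x ^ 2 := by positivity
  have hle := exp_sq_le_exp_sub_cos x θ
  rw [norm_of_nonneg (div_nonneg (by positivity) (hlow.le.trans hle))]
  refine (div_le_div_of_nonneg_left (by positivity) hlow hle).trans_eq ?_
  rw [one_mul, exp_neg]
  field_simp

/-- The series `∑ sin (n * θ) / n ^ (m + 1)` as a Bose–Einstein type integral. -/
lemma hasSum_factorial_mul_sin_div_pow {m : ℕ} (hm : m ≠ 0) (θ : ℝ) :
    HasSum (fun n : ℕ => m.factorial * (sin ((n + 1 : ℝ) * θ) / (n + 1 : ℝ) ^ (m + 1)))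
      (sin θ * ∫ x in Set.Ioi (0 : ℝ),
        x ^ m * exp x / (exp (2 * x) - 2 * exp x * cos θ + 1)) := by
  let F : ℕ → ℝ → ℝ := fun n x => sin ((n + 1 : ℝ) * θ) * (x ^ m * exp (-((n + 1 : ℝ) * x)))
  have hF (n : ℕ) : IntegrableOn (F n) (Set.Ioi 0) :=
    (integrableOn_pow_mul_exp_neg_mul m n.cast_add_one_pos).const_mul _
  have hnorm (n : ℕ) : ∫ x in Set.Ioi (0 : ℝ), ‖F n x‖ =
      |sin ((n + 1 : ℝ) * θ)| * (m.factorial / (n + 1 : ℝ) ^ (m + 1)) := by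
    rw [← integral_pow_mul_exp_neg_mul m n.cast_add_one_pos, ← integral_const_mul]
    refine setIntegral_congr_fun measurableSet_Ioi fun x (hx : 0 < x) => ?_
    simp only [F, norm_mul, norm_eq_abs, abs_exp, abs_pow, abs_of_pos hx]
  have hsum : Summable fun n : ℕ => ∫ x in Set.Ioi (0 : ℝ), ‖F n x‖ := by
    simp only [hnorm]
    have hp : Summable fun n : ℕ => (m.factorial : ℝ) / (n + 1 : ℝ) ^ (m + 1) := by
      have h := (summable_nat_add_iff 1).2
        (Real.summable_one_div_nat_pow.2 (by omega : 1 < m + 1))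
      simpa [div_eq_mul_inv] using h.mul_left (m.factorial : ℝ)
    refine hp.of_nonneg_of_le (fun n => by positivity) fun n => ?_
    exact mul_le_of_le_one_left (by positivity) (abs_sin_le_one _)
  have key := hasSum_integral_of_summable_integral_norm hF hsum
  convert! key using 1
  · ext n
    simp only [F]
    rw [integral_const_mul, integral_pow_mul_exp_neg_mul m n.cast_add_one_pos]
    ring
  · rw [← integral_const_mul]
    refine setIntegral_congr_fun measurableSet_Ioi fun x (hx : 0 < x) => ?_
    have h := ((hasSum_sin_mul_exp_neg hx θ).mul_left (x ^ m)).tsum_eq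
    calc _ = x ^ m * (sin θ * exp x / (exp (2 * x) - 2 * exp x * cos θ + 1)) := by ring
      _ = _ := by
        rw [← h]
        exact tsum_congr fun n => by simp only [F]; ring

/-- Integral formula for the imaginary part of the polylogarithm: for `a ∉ ℤ` and `l ∈ ℕ`,
`(2l+1)! · ∑_{n≥1} sin(2πna)/n^{2l+2} = sin(2πa) · ∫_0^∞ x^{2l+1} e^x / |e^x - e^{2πia}|² dx`,
where `|e^x - e^{2πia}|² = e^{2x} - 2 e^x cos(2πa) + 1`, and the integrand is integrable. -/
theorem im_polylog_integral_formula (a : ℝ) (ha : ∀ k : ℤ, a ≠ k) (l : ℕ) :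
    IntegrableOn
      (fun x : ℝ => x ^ (2 * l + 1) * Real.exp x /
        (Real.exp (2 * x) - 2 * Real.exp x * Real.cos (2 * Real.pi * a) + 1))
      (Set.Ioi 0) ∧
    (Nat.factorial (2 * l + 1) : ℝ) *
        (∑' n : ℕ+, Real.sin (2 * Real.pi * (n : ℝ) * a) / (n : ℝ) ^ (2 * l + 2))
      = Real.sin (2 * Real.pi * a) *
        ∫ x in Set.Ioi (0 : ℝ), x ^ (2 * l + 1) * Real.exp x /
          (Real.exp (2 * x) - 2 * Real.exp x * Real.cos (2 * Real.pi * a) + 1) := by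
  refine ⟨integrableOn_pow_mul_exp_div _ ?_, ?_⟩
  · refine lt_of_le_of_ne (cos_le_one _) fun h => ?_
    obtain ⟨k, hk⟩ := (cos_eq_one_iff _).1 h
    refine ha k (mul_left_cancel₀ two_pi_pos.ne' ?_)
    rw [← hk, mul_comm]
  · rw [← (hasSum_factorial_mul_sin_div_pow (by omega) _).tsum_eq, ← tsum_mul_left,
      tsum_pnat_eq_tsum_succ (f := fun n : ℕ => ((2 * l + 1).factorial : ℝ) *
        (sin (2 * π * (n : ℝ) * a) / (n : ℝ) ^ (2 * l + 2)))]
    refine tsum_congr fun n => ?_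
    push_cast
    ring_nf
end

section
/- Let a be a real number with 2a ∉ ℤ and let l ∈ ℕ. If sin(2πa) > 0 then ∑_{n=1}^∞ sin(2πna)/n^{2l+2} > 0, and if sin(2πa) < 0 then ∑_{n=1}^∞ sin(2πna)/n^{2l+2} < 0. In other words, for every l ∈ ℕ the sum ∑_{n=1}^∞ sin(2πna)/n^{2l+2} has the same (nonzero) sign as sin(2πa). -/
open Real

/-- The imaginary part of the geometric series in `r * exp (θ * I)`. -/
theorem hasSum_pnat_pow_mul_sin {r : ℝ} (hr0 : 0 ≤ r) (hr1 : r < 1) (θ : ℝ) :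
    HasSum (fun n : ℕ+ => r ^ (n : ℕ) * Real.sin ((n : ℝ) * θ))
      (r * Real.sin θ / (1 - 2 * r * Real.cos θ + r ^ 2)) := by
  have hz : ‖(r : ℂ) * Complex.exp (θ * Complex.I)‖ < 1 := by
    simpa [Complex.norm_exp_ofReal_mul_I, abs_of_nonneg hr0] using hr1
  have key := Complex.hasSum_im (hasSum_geometric_of_norm_lt_one hz)
  have hterm (n : ℕ) : (((r : ℂ) * Complex.exp (θ * Complex.I)) ^ n).im =
      r ^ n * Real.sin ((n : ℝ) * θ) := by
    rw [mul_pow, ← Complex.exp_nat_mul, ← mul_assoc, ← Complex.ofReal_pow,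
      Complex.im_ofReal_mul]
    congr 1
    exact_mod_cast Complex.exp_ofReal_mul_I_im ((n : ℝ) * θ)
  have hval : ((1 - (r : ℂ) * Complex.exp (θ * Complex.I))⁻¹).im =
      r * Real.sin θ / (1 - 2 * r * Real.cos θ + r ^ 2) := by
    rw [Complex.inv_im, Complex.normSq_apply]
    simp only [Complex.sub_im, Complex.sub_re, Complex.one_im, Complex.one_re,
      Complex.im_ofReal_mul, Complex.re_ofReal_mul, Complex.exp_ofReal_mul_I_re,
      Complex.exp_ofReal_mul_I_im]
    congr 1
    · ring
    · linear_combination r ^ 2 * Real.sin_sq_add_cos_sq θ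
  simp only [hterm, hval] at key
  refine (PNat.coe_injective.hasSum_iff (fun n hn => ?_)).2 key
  obtain rfl : n = 0 := by
    by_contra h
    exact hn ⟨⟨n, Nat.pos_of_ne_zero h⟩, rfl⟩
  simp

theorem sin_sq_le_one_sub_two_mul_mul_cos_add_sq (r θ : ℝ) :
    Real.sin θ ^ 2 ≤ 1 - 2 * r * Real.cos θ + r ^ 2 := by
  nlinarith [Real.sin_sq_add_cos_sq θ, sq_nonneg (r - Real.cos θ)]

/-- The sine Dirichlet series as the Mellin transform of the imaginary part of a geometric
series. -/
theorem hasSum_integral_sin_div_rpow {s : ℝ} (hs : 1 < s) (θ : ℝ) :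
    HasSum (fun n : ℕ+ => Real.Gamma s * (Real.sin ((n : ℝ) * θ) / (n : ℝ) ^ s))
      (∫ t in Set.Ioi (0 : ℝ), t ^ (s - 1) * (Real.exp (-t) * Real.sin θ /
        (1 - 2 * Real.exp (-t) * Real.cos θ + Real.exp (-t) ^ 2))) := by
  have hs0 : 0 < s := by linarith
  have hint (n : ℕ+) : MeasureTheory.IntegrableOn
      (fun t : ℝ => t ^ (s - 1) * Real.exp (-((n : ℝ) * t))) (Set.Ioi 0) := by
    have := integrableOn_rpow_mul_exp_neg_mul_rpow (s := s - 1) (p := 1) (b := (n : ℝ))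
      (by linarith) one_pos (by positivity)
    simpa [neg_mul] using this
  have hval (n : ℕ+) : ∫ t in Set.Ioi (0 : ℝ), t ^ (s - 1) * Real.exp (-((n : ℝ) * t)) =
      Real.Gamma s / (n : ℝ) ^ s := by
    rw [Real.integral_rpow_mul_exp_neg_mul_Ioi hs0 (by positivity),
      Real.div_rpow zero_le_one (by positivity), Real.one_rpow]
    ring
  let F : ℕ+ → ℝ → ℝ := fun n t =>
    t ^ (s - 1) * Real.exp (-((n : ℝ) * t)) * Real.sin ((n : ℝ) * θ)
  have hsum : Summable fun n : ℕ+ => ∫ t in Set.Ioi (0 : ℝ), ‖F n t‖ := by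
    have hz : Summable fun n : ℕ+ => Real.Gamma s * (1 / (n : ℝ) ^ s) :=
      ((Real.summable_one_div_nat_rpow.2 hs).comp_injective PNat.coe_injective).mul_left _
    refine hz.of_nonneg_of_le (fun n => by positivity) fun n => ?_
    rw [mul_one_div, ← hval n]
    refine MeasureTheory.setIntegral_mono_on ((hint n).mul_const _).norm (hint n)
      measurableSet_Ioi fun t ht => ?_
    have ht0 : (0 : ℝ) ≤ t ^ (s - 1) * Real.exp (-((n : ℝ) * t)) :=
      mul_nonneg (Real.rpow_nonneg (le_of_lt ht) _) (Real.exp_pos _).le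
    rw [norm_mul, Real.norm_of_nonneg ht0]
    exact mul_le_of_le_one_right ht0 (Real.abs_sin_le_one _)
  have key := MeasureTheory.hasSum_integral_of_summable_integral_norm
    (fun n => (hint n).mul_const _) hsum
  have hcoeff : (fun n : ℕ+ => Real.Gamma s * (Real.sin ((n : ℝ) * θ) / (n : ℝ) ^ s)) =
      fun n => ∫ t in Set.Ioi (0 : ℝ), F n t := by
    funext n
    rw [MeasureTheory.integral_mul_const, hval]
    ring
  rw [hcoeff, MeasureTheory.setIntegral_congr_fun (g := fun t => ∑' n, F n t) measurableSet_Ioi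
    fun t ht => ?_]
  · exact key
  · have hr : Real.exp (-t) < 1 := Real.exp_lt_one_iff.2 (neg_lt_zero.2 ht)
    simp only [← (hasSum_pnat_pow_mul_sin (Real.exp_pos (-t)).le hr θ).tsum_eq,
      ← tsum_mul_left]
    refine tsum_congr fun n => ?_
    simp only [F]
    rw [← Real.exp_nat_mul, mul_neg, mul_assoc]

theorem tsum_sin_div_rpow_pos {s : ℝ} (hs : 1 < s) {θ : ℝ} (hθ : 0 < Real.sin θ) :
    0 < ∑' n : ℕ+, Real.sin ((n : ℝ) * θ) / (n : ℝ) ^ s := by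
  have hs0 : 0 < s := by linarith
  have hD (r : ℝ) : 0 < 1 - 2 * r * Real.cos θ + r ^ 2 :=
    (pow_pos hθ 2).trans_le (sin_sq_le_one_sub_two_mul_mul_cos_add_sq r θ)
  refine pos_of_mul_pos_right ?_ (Real.Gamma_pos_of_pos hs0).le
  rw [← tsum_mul_left, (hasSum_integral_sin_div_rpow hs θ).tsum_eq]
  have hpos : ∀ t ∈ Set.Ioi (0 : ℝ), 0 < t ^ (s - 1) * (Real.exp (-t) * Real.sin θ /
      (1 - 2 * Real.exp (-t) * Real.cos θ + Real.exp (-t) ^ 2)) := fun t ht =>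
    mul_pos (Real.rpow_pos_of_pos ht _) (div_pos (mul_pos (Real.exp_pos _) hθ) (hD _))
  have hint : MeasureTheory.IntegrableOn (fun t : ℝ => t ^ (s - 1) * (Real.exp (-t) *
      Real.sin θ / (1 - 2 * Real.exp (-t) * Real.cos θ + Real.exp (-t) ^ 2))) (Set.Ioi 0) := by
    refine ((Real.GammaIntegral_convergent hs0).mul_const (Real.sin θ)⁻¹).mono' ?_ ?_
    · exact Measurable.aestronglyMeasurable (by fun_prop)
    · refine (MeasureTheory.ae_restrict_iff' measurableSet_Ioi).2 (.of_forall fun t ht => ?_)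
      rw [Real.norm_of_nonneg (hpos t ht).le, mul_comm (Real.exp (-t)) (t ^ (s - 1)),
        mul_assoc (t ^ (s - 1))]
      refine mul_le_mul_of_nonneg_left ?_ (Real.rpow_nonneg (le_of_lt ht) _)
      rw [div_le_iff₀ (hD _), mul_assoc (Real.exp (-t))]
      refine mul_le_mul_of_nonneg_left ?_ (Real.exp_pos _).le
      rw [inv_mul_eq_div, le_div_iff₀ hθ, ← sq]
      exact sin_sq_le_one_sub_two_mul_mul_cos_add_sq _ θ
  rw [MeasureTheory.setIntegral_pos_iff_support_of_nonneg_ae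
    ((MeasureTheory.ae_restrict_iff' measurableSet_Ioi).2
      (.of_forall fun t ht => (hpos t ht).le)) hint,
    Set.inter_eq_right.2 fun t ht => Function.mem_support.2 (hpos t ht).ne']
  simp

/-- For `2a ∉ ℤ` and `l ∈ ℕ`, the sum `∑_{n≥1} sin(2πna)/n^{2l+2}` has the same (nonzero)
sign as `sin(2πa)`. -/
theorem sign_im_polylog (a : ℝ) (ha : ∀ k : ℤ, 2 * a ≠ k) (l : ℕ) :
    (0 < Real.sin (2 * Real.pi * a) →
      0 < ∑' n : ℕ+, Real.sin (2 * Real.pi * (n : ℝ) * a) / (n : ℝ) ^ (2 * l + 2)) ∧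
    (Real.sin (2 * Real.pi * a) < 0 →
      (∑' n : ℕ+, Real.sin (2 * Real.pi * (n : ℝ) * a) / (n : ℝ) ^ (2 * l + 2)) < 0) := by
  have hpos (b : ℝ) (hb : 0 < Real.sin (2 * Real.pi * b)) :
      0 < ∑' n : ℕ+, Real.sin (2 * Real.pi * (n : ℝ) * b) / (n : ℝ) ^ (2 * l + 2) := by
    have hs : (1 : ℝ) < ((2 * l + 2 : ℕ) : ℝ) := by exact_mod_cast (by omega)
    refine (tsum_sin_div_rpow_pos hs hb).trans_eq (tsum_congr fun n => ?_)
    rw [Real.rpow_natCast]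
    congr 2
    ring
  refine ⟨hpos a, fun h => ?_⟩
  have hneg := hpos (-a) (by simpa using h)
  simpa only [mul_neg, Real.sin_neg, neg_div, tsum_neg, Left.neg_pos_iff] using hneg
end

section
/- Let α, β be real numbers and let g₃₃, g₄₄, g₅₅ be positive real numbers; set m = (g₄₄ + g₅₅)/2. Consider the 3×3 complex matrix S = (4π²·i/√g₃₃) · M, where M has rows [0, √(g₄₄/g₅₅)·β²/√2, −√(g₄₄/g₅₅)·αβ], [−(√(g₄₄·g₅₅)/m)·β²/√2, 0, (√(g₄₄·g₅₅)/m)·α²/√2], and [√(g₅₅/g₄₄)·αβ, −√(g₅₅/g₄₄)·α²/√2, 0]. Then the trace of S is 0 and the determinant of S is 0; consequently the characteristic polynomial of S has the form X³ + c·X for some c ∈ ℂ, so the spectrum of S is symmetric about zero: for every z ∈ ℂ, z is an eigenvalue of S if and only if −z is an eigenvalue of S. -/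
open Real Complex Matrix Polynomial

/-- A traceless singular `3 × 3` matrix has characteristic polynomial `X³ + c·X`. -/
theorem charpoly_fin_three_eq_of_trace_det_eq_zero {R : Type*} [CommRing R]
    (A : Matrix (Fin 3) (Fin 3) R) (ht : A.trace = 0) (hd : A.det = 0) :
    ∃ c : R, A.charpoly = X ^ 3 + C c * X := by
  refine ⟨A 0 0 * A 1 1 + A 0 0 * A 2 2 + A 1 1 * A 2 2
    - A 0 1 * A 1 0 - A 0 2 * A 2 0 - A 1 2 * A 2 1, ?_⟩
  have trace_eq := congrArg (C : R → R[X]) ht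
  have det_eq := congrArg (C : R → R[X]) hd
  rw [Matrix.trace_fin_three] at trace_eq
  rw [Matrix.det_fin_three] at det_eq
  simp only [map_add, map_sub, map_mul, map_zero] at trace_eq det_eq
  rw [Matrix.charpoly, Matrix.det_fin_three]
  simp only [map_add, map_sub, map_mul, Matrix.charmatrix_apply_eq,
    Matrix.charmatrix_apply_ne _ _ _ (show (0 : Fin 3) ≠ 1 by decide),
    Matrix.charmatrix_apply_ne _ _ _ (show (0 : Fin 3) ≠ 2 by decide),
    Matrix.charmatrix_apply_ne _ _ _ (show (1 : Fin 3) ≠ 0 by decide),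
    Matrix.charmatrix_apply_ne _ _ _ (show (1 : Fin 3) ≠ 2 by decide),
    Matrix.charmatrix_apply_ne _ _ _ (show (2 : Fin 3) ≠ 0 by decide),
    Matrix.charmatrix_apply_ne _ _ _ (show (2 : Fin 3) ≠ 1 by decide)]
  linear_combination -X ^ 2 * trace_eq - det_eq

/-- If the characteristic polynomial is `X³ + c·X`, the spectrum is symmetric about zero. -/
theorem mem_spectrum_iff_neg_mem_of_charpoly_eq {K n : Type*} [Field K] [Fintype n]
    [DecidableEq n] {A : Matrix n n K} {c : K} (h : A.charpoly = X ^ 3 + C c * X) (z : K) :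
    z ∈ spectrum K A ↔ -z ∈ spectrum K A := by
  rw [Matrix.mem_spectrum_iff_isRoot_charpoly, Matrix.mem_spectrum_iff_isRoot_charpoly, h]
  simp only [IsRoot.def, eval_add, eval_mul, eval_pow, eval_X, eval_C]
  rw [← neg_eq_zero]
  ring_nf

/-- The Rumin operator in a scalar representation `ρ_{α,β}`: the explicit 3×3 matrix `S` has
vanishing trace and determinant, so its characteristic polynomial is of the form `X³ + c·X`
and its spectrum is symmetric about zero. -/
theorem scalar_representation_spectrum_symmetric
    (α β g33 g44 g55 : ℝ) (h33 : 0 < g33) (h44 : 0 < g44) (h55 : 0 < g55)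
    (m : ℝ) (hm : m = (g44 + g55) / 2)
    (S : Matrix (Fin 3) (Fin 3) ℂ)
    (hS : S = (4 * (Real.pi : ℂ) ^ 2 * Complex.I / ((Real.sqrt g33 : ℝ) : ℂ)) •
      !![(0 : ℂ),
         ((Real.sqrt (g44 / g55) * β ^ 2 / Real.sqrt 2 : ℝ) : ℂ),
         ((-(Real.sqrt (g44 / g55) * α * β) : ℝ) : ℂ);
         ((-(Real.sqrt (g44 * g55) / m * β ^ 2 / Real.sqrt 2) : ℝ) : ℂ),
         (0 : ℂ),
         ((Real.sqrt (g44 * g55) / m * α ^ 2 / Real.sqrt 2 : ℝ) : ℂ);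
         ((Real.sqrt (g55 / g44) * α * β : ℝ) : ℂ),
         ((-(Real.sqrt (g55 / g44) * α ^ 2 / Real.sqrt 2) : ℝ) : ℂ),
         (0 : ℂ)]) :
    S.trace = 0 ∧ S.det = 0 ∧
    (∃ c : ℂ, S.charpoly = X ^ 3 + C c * X) ∧
    (∀ z : ℂ, z ∈ spectrum ℂ S ↔ -z ∈ spectrum ℂ S) := by
  have ht : S.trace = 0 := by
    rw [hS, Matrix.trace_smul, Matrix.trace_fin_three]
    simp
  have hd : S.det = 0 := by
    rw [hS, Matrix.det_smul, Matrix.det_fin_three]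
    refine mul_eq_zero_of_right _ ?_
    simp only [Matrix.of_apply, Matrix.cons_val', Matrix.cons_val_zero, Matrix.cons_val_one,
      Matrix.cons_val, Matrix.cons_val_fin_one]
    push_cast
    ring
  obtain ⟨c, hc⟩ := charpoly_fin_three_eq_of_trace_det_eq_zero S ht hd
  exact ⟨ht, hd, ⟨c, hc⟩, mem_spectrum_iff_neg_mem_of_charpoly_eq hc⟩
end
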